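/- arXiv:1912.04725 — 2 statements merged into one kernel-verified Lean document; each statement's English description precedes it below -/
import Mathlib

section
/- For any permutation σ in S_n, σ is smooth (i.e., ℓ(σ) equals the number of transpositions τ with τ ≤ σ in Bruhat order) if and only if σ avoids the patterns 4231 and 3412. -/
namespace SmoothPerm

variable {n : ℕ}

/-- Bruhat order on `S_n`, via the standard counting criterion. -/
def bruhatLE (τ σ : Equiv.Perm (Fin n)) : Prop :=
  ∀ i j : Fin n,
    (Finset.univ.filter (fun x => x ≤ i ∧ σ x ≤ j)).card ≤
      (Finset.univ.filter (fun x => x ≤ i ∧ τ x ≤ j)).card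

/-- Number of inversions (the length ℓ(σ)). -/
def invNum (σ : Equiv.Perm (Fin n)) : ℕ :=
  (Finset.univ.filter (fun p : Fin n × Fin n => p.1 < p.2 ∧ σ p.2 < σ p.1)).card

def isTransposition (τ : Equiv.Perm (Fin n)) : Prop :=
  ∃ i j : Fin n, i < j ∧ τ = Equiv.swap i j

/-- σ is smooth iff ℓ(σ) equals the number of transpositions Bruhat-below σ. -/
def smooth (σ : Equiv.Perm (Fin n)) : Prop :=
  invNum σ = Nat.card {τ : Equiv.Perm (Fin n) // isTransposition τ ∧ bruhatLE τ σ}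

def avoids4231 (σ : Equiv.Perm (Fin n)) : Prop :=
  ¬ ∃ a b c d : Fin n, a < b ∧ b < c ∧ c < d ∧ σ d < σ b ∧ σ b < σ c ∧ σ c < σ a

/-- covexillary = 3412-avoiding. -/
def covexillary (σ : Equiv.Perm (Fin n)) : Prop :=
  ¬ ∃ a b c d : Fin n, a < b ∧ b < c ∧ c < d ∧ σ c < σ d ∧ σ d < σ a ∧ σ a < σ b

def avoids321 (σ : Equiv.Perm (Fin n)) : Prop :=
  ¬ ∃ a b c : Fin n, a < b ∧ b < c ∧ σ c < σ b ∧ σ b < σ a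

/-- The 3-cycle i ↦ j ↦ k ↦ i. -/
def Rc (i j k : Fin n) : Equiv.Perm (Fin n) := Equiv.swap i k * Equiv.swap i j

def Lc (i j k : Fin n) : Equiv.Perm (Fin n) := (Rc i j k)⁻¹

def inC23 (τ : Equiv.Perm (Fin n)) : Prop :=
  isTransposition τ ∨ ∃ i j k : Fin n, i < j ∧ j < k ∧ (τ = Rc i j k ∨ τ = Lc i j k)

/-- The 2-3-table of σ. -/
def Ctab (σ : Equiv.Perm (Fin n)) : Set (Equiv.Perm (Fin n)) :=
  {τ | inC23 τ ∧ bruhatLE τ σ}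

def admissible (A : Set (Equiv.Perm (Fin n))) : Prop :=
  (∀ τ ∈ A, inC23 τ) ∧
  (∀ σ ∈ A, ∀ τ : Equiv.Perm (Fin n), inC23 τ → bruhatLE τ σ → τ ∈ A) ∧
  (∀ i j k l : Fin n, i < j → j < l → i < k → k < l →
    Rc i j l ∈ A → Lc i k l ∈ A → Equiv.swap i l ∈ A) ∧
  (∀ i j k : Fin n, i < j → j < k →
    Equiv.swap i j ∈ A → Equiv.swap j k ∈ A → (Rc i j k ∈ A ∨ Lc i j k ∈ A))

def isWedge (A : Set (Equiv.Perm (Fin n))) (i j : Fin n) : Prop :=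
  i < j ∧ Equiv.swap i j ∈ A ∧
  (∀ i' : Fin n, (i' : ℕ) + 1 = (i : ℕ) → Equiv.swap i' i ∉ A) ∧
  (∀ j' : Fin n, (j : ℕ) + 1 = (j' : ℕ) → Rc i j j' ∉ A)

def derivedSet (A : Set (Equiv.Perm (Fin n))) (i j : Fin n) : Set (Equiv.Perm (Fin n)) :=
  A \ ({Equiv.swap i j} ∪ {τ | ∃ k, j < k ∧ τ = Lc i j k} ∪
       {τ | ∃ k, i < k ∧ k < j ∧ τ = Rc i k j})

def strictTotalOn (S : Set (Equiv.Perm (Fin n)))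
    (r : Equiv.Perm (Fin n) → Equiv.Perm (Fin n) → Prop) : Prop :=
  (∀ x ∈ S, ¬ r x x) ∧
  (∀ x ∈ S, ∀ y ∈ S, ∀ z ∈ S, r x y → r y z → r x z) ∧
  (∀ x ∈ S, ∀ y ∈ S, x ≠ y → r x y ∨ r y x)

def compatibleOrder (A : Set (Equiv.Perm (Fin n)))
    (r : Equiv.Perm (Fin n) → Equiv.Perm (Fin n) → Prop) : Prop :=
  (∀ i j k : Fin n, i < j → j < k → Rc i j k ∈ A → Lc i j k ∉ A →
    r (Equiv.swap i j) (Equiv.swap j k)) ∧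
  (∀ i j k : Fin n, i < j → j < k → Lc i j k ∈ A → Rc i j k ∉ A →
    r (Equiv.swap j k) (Equiv.swap i j)) ∧
  (∀ i j k : Fin n, i < j → j < k → Equiv.swap i k ∈ A →
    ((r (Equiv.swap i j) (Equiv.swap i k) ∧ r (Equiv.swap i k) (Equiv.swap j k)) ∨
     (r (Equiv.swap j k) (Equiv.swap i k) ∧ r (Equiv.swap i k) (Equiv.swap i j))))

def coversIn (S : Set (Equiv.Perm (Fin n)))
    (r : Equiv.Perm (Fin n) → Equiv.Perm (Fin n) → Prop)
    (x y : Equiv.Perm (Fin n)) : Prop :=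
  x ∈ S ∧ y ∈ S ∧ r x y ∧ ∀ z ∈ S, ¬ (r x z ∧ r z y)

/-- m_σ(i) = max σ([i]). -/
def maxS (σ : Equiv.Perm (Fin n)) (i : Fin n) : Fin n :=
  ((Finset.univ.filter (fun x => x ≤ i)).image (fun x => σ x)).max'
    ⟨σ i, Finset.mem_image_of_mem _ (by simp)⟩

/-- The cyclic shift i → i+1 → ⋯ → j → i. -/
def Rseg (i j : Fin n) : Equiv.Perm (Fin n) :=
  ((List.finRange n).filter (fun x => decide (i ≤ x ∧ x ≤ j))).formPerm

def definedByInclusions (σ : Equiv.Perm (Fin n)) : Prop :=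
  ∀ τ : Equiv.Perm (Fin n),
    (∀ x, maxS τ x ≤ maxS σ x) → (∀ x, maxS τ⁻¹ x ≤ maxS σ⁻¹ x) → bruhatLE τ σ

/-! ### Helper lemmas -/

/-- The pairs `i < j` with `swap i j` Bruhat-below `σ`. -/
def prs {n : ℕ} (σ : Equiv.Perm (Fin n)) : Finset (Fin n × Fin n) :=
  Finset.univ.filter fun q => q.1 < q.2 ∧ (∃ x, x ≤ q.1 ∧ q.2 ≤ σ x) ∧ (∃ y, q.2 ≤ y ∧ σ y ≤ q.1)

theorem mem_prs {n : ℕ} (σ : Equiv.Perm (Fin n)) (i j : Fin n) :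
    (i, j) ∈ prs σ ↔ i < j ∧ (∃ x, x ≤ i ∧ j ≤ σ x) ∧ (∃ y, j ≤ y ∧ σ y ≤ i) := by
  simp [prs]

theorem card_pos_le {n : ℕ} (a : Fin n) :
    (Finset.univ.filter (fun x : Fin n => x ≤ a)).card = (a : ℕ) + 1 := by
  rw [← Fin.card_Iic]; congr 1; ext; simp

theorem card_val_le {n : ℕ} (σ : Equiv.Perm (Fin n)) (b : Fin n) :
    (Finset.univ.filter (fun x : Fin n => σ x ≤ b)).card = (b : ℕ) + 1 := by
  rw [← card_pos_le b]
  exact Finset.card_equiv σ (by simp)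

theorem card_val_lt {n : ℕ} (σ : Equiv.Perm (Fin n)) (b : Fin n) :
    (Finset.univ.filter (fun x : Fin n => σ x < b)).card = (b : ℕ) := by
  rw [← Fin.card_Iio b]
  exact Finset.card_equiv σ (by simp)

theorem rank_swap_ge {n : ℕ} (i j a b : Fin n) (hij : i < j)
    (h : ¬ (i ≤ a ∧ a < j ∧ i ≤ b ∧ b < j)) :
    ((min a b : Fin n) : ℕ) + 1 ≤
      (Finset.univ.filter (fun x => x ≤ a ∧ Equiv.swap i j x ≤ b)).card := by
  by_cases ha : j ≤ a
  · rw [← card_val_le (Equiv.swap i j) (min a b)]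
    apply Finset.card_le_card
    intro x
    simp only [Finset.mem_filter, Finset.mem_univ, true_and, le_min_iff]
    rintro ⟨h1, h2⟩
    refine ⟨?_, h2⟩
    rw [Equiv.swap_apply_def] at h1
    split_ifs at h1 <;> order
  · rw [← card_pos_le (min a b)]
    apply Finset.card_le_card
    intro x
    simp only [Finset.mem_filter, Finset.mem_univ, true_and, le_min_iff]
    rintro ⟨h1, h2⟩
    refine ⟨h1, ?_⟩
    rw [Equiv.swap_apply_def]
    split_ifs with h3 h4
    · subst h3; by_contra hc; apply h; refine ⟨h1, ?_, h2, ?_⟩ <;> order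
    · subst h4; order
    · exact h2

theorem rank_swap_box {n : ℕ} (i j a b : Fin n)
    (h : i ≤ a ∧ a < j ∧ i ≤ b ∧ b < j) :
    ((min a b : Fin n) : ℕ) =
      (Finset.univ.filter (fun x => x ≤ a ∧ Equiv.swap i j x ≤ b)).card := by
  have h1 : (Finset.univ.filter (fun x => x ≤ a ∧ Equiv.swap i j x ≤ b)) =
      (Finset.univ.filter (fun x : Fin n => x ≤ min a b)).erase i := by
    ext x
    simp only [Finset.mem_filter, Finset.mem_univ, true_and, le_min_iff, Finset.mem_erase]
    rw [Equiv.swap_apply_def]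
    obtain ⟨h1, h2, h3, h4⟩ := h
    split_ifs with h5 h6
    · constructor
      · rintro ⟨_, h⟩; order
      · rintro ⟨h, _⟩; exact absurd h5 h
    · constructor
      · rintro ⟨_, h⟩; order
      · rintro ⟨h, _⟩; order
    · tauto
  rw [h1, Finset.card_erase_of_mem, card_pos_le]
  · simp
  · simp [h.1, h.2.2.1]

theorem bruhat_swap_iff {n : ℕ} (σ : Equiv.Perm (Fin n)) (i j : Fin n) (hij : i < j) :
    bruhatLE (Equiv.swap i j) σ ↔ (i, j) ∈ prs σ := by
  rw [mem_prs]
  constructor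
  · intro h
    have hj : (j : ℕ) - 1 < n := by omega
    set k : Fin n := ⟨(j : ℕ) - 1, hj⟩ with hk
    have hik : i ≤ k := by rw [Fin.le_def]; simp [hk]; omega
    have hkj : k < j := by rw [Fin.lt_def]; simp [hk]; omega
    have hlt : ∀ y : Fin n, ¬ j ≤ y → y ≤ k := by
      intro y hy; rw [Fin.le_def] at *; simp [hk]; omega
    refine ⟨hij, ?_, ?_⟩
    · by_contra! hc
      have h1 := h i k
      rw [← rank_swap_box i j i k ⟨le_rfl, hij, hik, hkj⟩, min_eq_left hik] at h1
      have h2 : Finset.univ.filter (fun x => x ≤ i ∧ σ x ≤ k) =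
          Finset.univ.filter (fun x : Fin n => x ≤ i) := by
        ext x
        simp only [Finset.mem_filter, Finset.mem_univ, true_and]
        exact ⟨fun h => h.1, fun h => ⟨h, hlt _ (not_le.2 (hc x h))⟩⟩
      rw [h2, card_pos_le] at h1
      omega
    · by_contra! hc
      have h1 := h k i
      rw [← rank_swap_box i j k i ⟨hik, hkj, le_rfl, hij⟩, min_eq_right hik] at h1
      have h2 : Finset.univ.filter (fun x => x ≤ k ∧ σ x ≤ i) =
          Finset.univ.filter (fun x : Fin n => σ x ≤ i) := by
        ext x
        simp only [Finset.mem_filter, Finset.mem_univ, true_and]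
        exact ⟨fun h => h.2, fun h => ⟨hlt _ (fun h' => absurd h (not_le.2 (hc x h'))), h⟩⟩
      rw [h2, card_val_le] at h1
      omega
  · rintro ⟨-, ⟨x0, hx0, hx1⟩, ⟨y0, hy0, hy1⟩⟩ a b
    by_cases hb : i ≤ a ∧ a < j ∧ i ≤ b ∧ b < j
    · rw [← rank_swap_box i j a b hb]
      obtain ⟨h1, h2, h3, h4⟩ := hb
      have e1 : (Finset.univ.filter (fun x => x ≤ a ∧ σ x ≤ b)).card ≤ a := by
        have : (Finset.univ.filter (fun x => x ≤ a ∧ σ x ≤ b)) ⊆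
            (Finset.univ.filter (fun x : Fin n => x ≤ a)).erase x0 := by
          intro x
          simp only [Finset.mem_filter, Finset.mem_univ, true_and, Finset.mem_erase]
          rintro ⟨h5, h6⟩
          refine ⟨?_, h5⟩
          rintro rfl
          order
        have := Finset.card_le_card this
        rwa [Finset.card_erase_of_mem (by simp; order), card_pos_le] at this
      have e2 : (Finset.univ.filter (fun x => x ≤ a ∧ σ x ≤ b)).card ≤ b := by
        have : (Finset.univ.filter (fun x => x ≤ a ∧ σ x ≤ b)) ⊆
            (Finset.univ.filter (fun x : Fin n => σ x ≤ b)).erase y0 := by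
          intro x
          simp only [Finset.mem_filter, Finset.mem_univ, true_and, Finset.mem_erase]
          rintro ⟨h5, h6⟩
          refine ⟨?_, h6⟩
          rintro rfl
          order
        have := Finset.card_le_card this
        rwa [Finset.card_erase_of_mem (by simp; order), card_val_le] at this
      rcases min_choice a b with h | h <;> rw [h] <;> assumption
    · refine le_trans ?_ (rank_swap_ge i j a b hij hb)
      rcases min_choice a b with h | h <;> rw [h]
      · rw [← card_pos_le a]
        exact Finset.card_le_card (fun x => by simp; tauto)
      · rw [← card_val_le σ b]
        exact Finset.card_le_card (fun x => by simp)

theorem swap_inj_lt {n : ℕ} {i j k l : Fin n} (hij : i < j) (hkl : k < l)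
    (h : Equiv.swap i j = Equiv.swap k l) : i = k ∧ j = l := by
  have h1 : Equiv.swap k l i = j := by rw [← h]; simp
  have h2 : Equiv.swap k l j = i := by rw [← h]; simp
  rw [Equiv.swap_apply_def] at h1 h2
  split_ifs at h1 h2 <;> subst_vars <;> first | exact ⟨rfl, rfl⟩ | order

theorem card_below {n : ℕ} (σ : Equiv.Perm (Fin n)) :
    Nat.card {τ : Equiv.Perm (Fin n) // isTransposition τ ∧ bruhatLE τ σ} = (prs σ).card := by
  have e : Nat.card {q // q ∈ prs σ} = (prs σ).card := by simp
  rw [← e]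
  symm
  refine Nat.card_congr (Equiv.ofBijective
    (fun q => ⟨Equiv.swap q.1.1 q.1.2, ⟨q.1.1, q.1.2, ?_, rfl⟩, ?_⟩) ⟨?_, ?_⟩)
  · exact ((mem_prs σ _ _).1 q.2).1
  · exact (bruhat_swap_iff σ _ _ ((mem_prs σ _ _).1 q.2).1).2 q.2
  · rintro ⟨⟨i, j⟩, h⟩ ⟨⟨k, l⟩, h'⟩ he
    have := swap_inj_lt ((mem_prs σ _ _).1 h).1 ((mem_prs σ _ _).1 h').1 (congrArg Subtype.val he)
    simp [this.1, this.2]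
  · rintro ⟨τ, ⟨i, j, hij, rfl⟩, h⟩
    exact ⟨⟨(i, j), (bruhat_swap_iff σ i j hij).1 h⟩, rfl⟩

/-! ### Deleting the largest value -/

/-- `σ'` is `σ` with the largest value (in position `p`) deleted. -/
structure Del {n : ℕ} (σ : Equiv.Perm (Fin (n + 1))) (p : Fin (n + 1))
    (σ' : Equiv.Perm (Fin n)) : Prop where
  last : σ p = Fin.last n
  del : ∀ x, (σ' x).castSucc = σ (p.succAbove x)

theorem exists_del {n : ℕ} (σ : Equiv.Perm (Fin (n + 1))) : ∃ p σ', Del σ p σ' := by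
  set p := σ.symm (Fin.last n) with hp
  have hp' : σ p = Fin.last n := by simp [hp]
  have h1 : ∀ x, σ (p.succAbove x) ≠ Fin.last n := by
    intro x h
    rw [← hp'] at h
    exact Fin.succAbove_ne p x (σ.injective h)
  let f : Fin n → Fin n := fun x => (σ (p.succAbove x)).castPred (h1 x)
  have hf : Function.Injective f := by
    intro x y h
    simp only [f, Fin.castPred_inj] at h
    exact Fin.succAbove_right_injective (σ.injective h)
  exact ⟨p, Equiv.ofBijective f (Finite.injective_iff_bijective.1 hf), hp', fun x => by simp [f]⟩

theorem succAbove_val {n : ℕ} (p : Fin (n + 1)) (x : Fin n) :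
    ((p.succAbove x : Fin (n+1)) : ℕ) = if (x : ℕ) < p then (x : ℕ) else x + 1 := by
  rw [Fin.succAbove]
  simp only [Fin.lt_def, Fin.val_castSucc]
  split_ifs <;> simp

theorem Del.ne_last {n : ℕ} {σ : Equiv.Perm (Fin (n + 1))} {p : Fin (n + 1)}
    {σ' : Equiv.Perm (Fin n)} (h : Del σ p σ') {x : Fin (n+1)} (hx : x ≠ p) :
    (σ x : ℕ) < n := by
  have : σ x ≠ Fin.last n := by rw [← h.last]; exact fun e => hx (σ.injective e)
  have := Fin.val_lt_last this
  simpa using this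

theorem Del.inv {n : ℕ} {σ : Equiv.Perm (Fin (n + 1))} {p : Fin (n + 1)}
    {σ' : Equiv.Perm (Fin n)} (h : Del σ p σ') : invNum σ = invNum σ' + (n - p) := by
  have key : Finset.univ.filter
      (fun q : Fin (n+1) × Fin (n+1) => q.1 < q.2 ∧ σ q.2 < σ q.1) =
      ((Finset.univ.filter (fun q : Fin n × Fin n => q.1 < q.2 ∧ σ' q.2 < σ' q.1)).image
        (fun q => (p.succAbove q.1, p.succAbove q.2))) ∪
      ((Finset.Ioi p).image (fun y => (p, y))) := by
    ext ⟨x, y⟩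
    simp only [Finset.mem_filter, Finset.mem_univ, true_and, Finset.mem_union, Finset.mem_image,
      Prod.exists, Finset.mem_Ioi, Prod.mk.injEq]
    constructor
    · rintro ⟨h1, h2⟩
      by_cases hx : x = p
      · right; exact ⟨y, by rw [← hx]; exact h1, hx.symm, rfl⟩
      · left
        have hy : y ≠ p := by
          rintro rfl; rw [h.last] at h2; exact absurd h2 (not_lt.2 (Fin.le_last _))
        obtain ⟨x', rfl⟩ := Fin.exists_succAbove_eq hx
        obtain ⟨y', rfl⟩ := Fin.exists_succAbove_eq hy
        refine ⟨x', y', ⟨?_, ?_⟩, rfl, rfl⟩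
        · simpa using h1
        · rw [← h.del, ← h.del] at h2; simpa using h2
    · rintro (⟨x', y', ⟨h1, h2⟩, rfl, rfl⟩ | ⟨y', h1, rfl, rfl⟩)
      · refine ⟨?_, ?_⟩
        · simpa using h1
        · rw [← h.del, ← h.del]; simpa using h2
      · refine ⟨h1, ?_⟩
        rw [h.last, Fin.lt_def]
        simpa using h.ne_last (ne_of_gt h1)
  unfold invNum
  rw [key, Finset.card_union_of_disjoint, Finset.card_image_of_injective,
    Finset.card_image_of_injective, Fin.card_Ioi]
  · simp
  · intro a b e; simpa using e
  · rintro ⟨a, a'⟩ ⟨b, b'⟩ e; simpa using e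
  · rw [Finset.disjoint_left]
    rintro ⟨x, y⟩ h1 h2
    simp only [Finset.mem_filter, Finset.mem_univ, true_and, Finset.mem_image,
      Prod.exists, Finset.mem_Ioi, Prod.mk.injEq] at h1 h2
    obtain ⟨x', y', _, hx, _⟩ := h1
    obtain ⟨_, _, hx', _⟩ := h2
    exact Fin.succAbove_ne p x' (hx.trans hx'.symm)

theorem exists_g {n : ℕ} (σ : Equiv.Perm (Fin n)) :
    ∃ g : Fin n → Fin n, ∀ i, σ (g i) ≤ i ∧ ∀ z, σ z ≤ i → z ≤ g i := by
  have : ∀ i, ∃ y, σ y ≤ i ∧ ∀ z, σ z ≤ i → z ≤ y := by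
    intro i
    obtain ⟨y, hy, h⟩ := Finset.exists_max_image (Finset.univ.filter (fun x => σ x ≤ i)) id
      ⟨σ.symm i, by simp⟩
    exact ⟨y, by simpa using hy, fun z hz => h z (by simpa using hz)⟩
  choose g hg using this
  exact ⟨g, hg⟩

/-- The part of `prs σ` coming from `σ'`. -/
def oldPrs {n : ℕ} (σ' : Equiv.Perm (Fin n)) : Finset (Fin (n + 1) × Fin (n + 1)) :=
  (prs σ').image (fun q => (q.1.castSucc, q.2.castSucc))

/-- The new part of `prs σ`. -/
def newPrs {n : ℕ} (p : Fin (n + 1)) (g : Fin (n + 1) → Fin (n + 1)) :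
    Finset (Fin (n + 1) × Fin (n + 1)) :=
  (Finset.Ico p (Fin.last n)).image (fun i => (i, g i))

theorem mem_oldPrs {n : ℕ} (σ' : Equiv.Perm (Fin n)) (i j : Fin (n + 1)) :
    (i, j) ∈ oldPrs σ' ↔ ∃ i' j', (i', j') ∈ prs σ' ∧ i'.castSucc = i ∧ j'.castSucc = j := by
  simp [oldPrs]

theorem mem_newPrs {n : ℕ} (p : Fin (n + 1)) (g : Fin (n + 1) → Fin (n + 1)) (i j : Fin (n + 1)) :
    (i, j) ∈ newPrs p g ↔ p ≤ i ∧ i < Fin.last n ∧ g i = j := by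
  simp only [newPrs, Finset.mem_image, Finset.mem_Ico, Prod.mk.injEq]
  constructor
  · rintro ⟨a, h, rfl, h'⟩; exact ⟨h.1, h.2, h'⟩
  · rintro ⟨h1, h2, h3⟩; exact ⟨i, ⟨h1, h2⟩, rfl, h3⟩

theorem Del.union_card {n : ℕ} {σ : Equiv.Perm (Fin (n + 1))} {p : Fin (n + 1)}
    {σ' : Equiv.Perm (Fin n)} (h : Del σ p σ') {g : Fin (n + 1) → Fin (n + 1)}
    (hg : ∀ i, σ (g i) ≤ i ∧ ∀ z, σ z ≤ i → z ≤ g i) :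
    (oldPrs σ' ∪ newPrs p g).card = (prs σ').card + (n - p) := by
  rw [Finset.card_union_of_disjoint]
  · rw [oldPrs, newPrs, Finset.card_image_of_injective, Finset.card_image_of_injective,
      Fin.card_Ico]
    · simp
    · intro a b e; simp at e; exact e.1
    · rintro ⟨a, a'⟩ ⟨b, b'⟩ e; simpa using e
  · rw [Finset.disjoint_left]
    rintro ⟨i, j⟩ h1 h2
    rw [mem_oldPrs] at h1
    rw [mem_newPrs] at h2
    obtain ⟨i', j', h1, rfl, rfl⟩ := h1
    rw [mem_prs] at h1
    obtain ⟨h3, -, y, h4, h5⟩ := h1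
    obtain ⟨h6, h7, h8⟩ := h2
    have h9 := (hg i'.castSucc).2 (p.succAbove y) (by rw [← h.del]; simpa using h5)
    rw [h8] at h9
    have := succAbove_val p y
    simp only [Fin.le_def, Fin.lt_def, Fin.val_castSucc] at *
    split_ifs at this <;> omega

theorem Del.union_subset {n : ℕ} {σ : Equiv.Perm (Fin (n + 1))} {p : Fin (n + 1)}
    {σ' : Equiv.Perm (Fin n)} (h : Del σ p σ') {g : Fin (n + 1) → Fin (n + 1)}
    (hg : ∀ i, σ (g i) ≤ i ∧ ∀ z, σ z ≤ i → z ≤ g i) :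
    oldPrs σ' ∪ newPrs p g ⊆ prs σ := by
  rintro ⟨i, j⟩ hm
  rw [Finset.mem_union, mem_oldPrs, mem_newPrs] at hm
  rw [mem_prs]
  rcases hm with ⟨i', j', h1, rfl, rfl⟩ | ⟨h1, h2, rfl⟩
  · rw [mem_prs] at h1
    obtain ⟨h1, ⟨x, h2, h3⟩, y, h4, h5⟩ := h1
    refine ⟨by simpa using h1, ?_, p.succAbove y, ?_, ?_⟩
    · by_cases hp : p ≤ i'.castSucc
      · exact ⟨p, hp, by rw [h.last]; exact Fin.le_last _⟩
      · refine ⟨p.succAbove x, ?_, by rw [← h.del]; simpa using h3⟩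
        have := succAbove_val p x
        simp only [Fin.le_def, Fin.lt_def, Fin.val_castSucc] at *
        split_ifs at this <;> omega
    · have := succAbove_val p y
      simp only [Fin.le_def, Fin.lt_def, Fin.val_castSucc] at *
      split_ifs at this <;> omega
    · rw [← h.del]; simpa using h5
  · refine ⟨?_, ⟨p, h1, by rw [h.last]; exact Fin.le_last _⟩, g i, le_rfl, (hg i).1⟩
    by_contra hc
    have hs : Finset.univ.filter (fun x => σ x ≤ i) ⊆
        (Finset.univ.filter (fun x => x ≤ i)).erase p := by
      intro z
      simp only [Finset.mem_filter, Finset.mem_univ, true_and, Finset.mem_erase]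
      intro hz
      refine ⟨?_, ((hg i).2 z hz).trans (not_lt.1 hc)⟩
      rintro rfl
      rw [h.last] at hz
      exact absurd hz (not_le.2 h2)
    have := Finset.card_le_card hs
    rw [Finset.card_erase_of_mem (by simpa using h1), card_pos_le, card_val_le] at this
    omega

theorem Del.card_ge {n : ℕ} {σ : Equiv.Perm (Fin (n + 1))} {p : Fin (n + 1)}
    {σ' : Equiv.Perm (Fin n)} (h : Del σ p σ') :
    (prs σ').card + (n - p) ≤ (prs σ).card := by
  obtain ⟨g, hg⟩ := exists_g σ
  rw [← h.union_card hg]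
  exact Finset.card_le_card (h.union_subset hg)

theorem inv_le : ∀ (n : ℕ) (σ : Equiv.Perm (Fin n)), invNum σ ≤ (prs σ).card := by
  intro n
  induction n with
  | zero => intro σ; simp [invNum]
  | succ n ih =>
    intro σ
    obtain ⟨p, σ', h⟩ := exists_del σ
    have := h.inv
    have := h.card_ge
    have := ih σ'
    omega

/-- The set of positions `≤ y` other than `p` cannot be mapped into few values. -/
theorem pigeon {n : ℕ} (σ : Equiv.Perm (Fin n)) (p y j : Fin n) (hp : p ≤ y) (hj : j < y)
    (h : ∀ x, x ≤ y → x ≠ p → σ x < j) : False := by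
  have hs : (Finset.univ.filter (fun x => x ≤ y)).erase p ⊆
      Finset.univ.filter (fun x => σ x < j) := by
    intro x
    simp only [Finset.mem_filter, Finset.mem_univ, true_and, Finset.mem_erase]
    rintro ⟨h1, h2⟩
    exact h x h2 h1
  have := Finset.card_le_card hs
  rw [Finset.card_erase_of_mem (by simpa using hp), card_pos_le, card_val_lt] at this
  rw [Fin.lt_def] at hj
  omega

theorem Del.subset_union {n : ℕ} {σ : Equiv.Perm (Fin (n + 1))} {p : Fin (n + 1)}
    {σ' : Equiv.Perm (Fin n)} (h : Del σ p σ') {g : Fin (n + 1) → Fin (n + 1)}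
    (hg : ∀ i, σ (g i) ≤ i ∧ ∀ z, σ z ≤ i → z ≤ g i)
    (h42 : avoids4231 σ) (h34 : covexillary σ) :
    prs σ ⊆ oldPrs σ' ∪ newPrs p g := by
  rintro ⟨i, j⟩ hm
  rw [Finset.mem_union, mem_oldPrs, mem_newPrs]
  rw [mem_prs] at hm
  obtain ⟨hij, ⟨x0, hx0, hx1⟩, y0, hy0, hy1⟩ := hm
  have hilast : i < Fin.last n := lt_of_lt_of_le hij (Fin.le_last _)
  obtain ⟨hgi, hgm⟩ := hg i
  set y := g i with hy
  have hjy : j ≤ y := hy0.trans (hgm y0 hy1)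
  have hltp : ∀ x, x ≠ p → σ x < σ p := by
    intro x hx; rw [h.last, Fin.lt_def]; simpa using h.ne_last hx
  have hyp : y ≠ p := by
    intro e; rw [e, h.last] at hgi; order
  -- a convenient way to produce an old pair
  have mk : ∀ x z : Fin (n+1), x ≠ p → z ≠ p → j ≤ σ x → σ z ≤ i → x ≤ i ∨ (p ≤ i ∧ (x:ℕ) ≤ i + 1) →
      (j ≤ z ∧ z < p ∨ j < z) → ∃ i' j', (i', j') ∈ prs σ' ∧ i'.castSucc = i ∧ j'.castSucc = j := by
    intro x z hx hz hjx hzi hxi hjz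
    have hjl : j ≠ Fin.last n := by
      rintro rfl
      have := hltp x hx
      rw [h.last] at this
      order
    obtain ⟨i', rfl⟩ := Fin.exists_castSucc_eq.2 hilast.ne
    obtain ⟨j', rfl⟩ := Fin.exists_castSucc_eq.2 hjl
    obtain ⟨x', rfl⟩ := Fin.exists_succAbove_eq hx
    obtain ⟨z', rfl⟩ := Fin.exists_succAbove_eq hz
    refine ⟨i', j', ?_, rfl, rfl⟩
    rw [mem_prs]
    rw [← h.del] at hjx hzi
    refine ⟨by simpa using hij, ⟨x', ?_, by simpa using hjx⟩, z', ?_, by simpa using hzi⟩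
    · have := succAbove_val p x'
      simp only [Fin.le_def, Fin.lt_def, Fin.val_castSucc] at *
      split_ifs at this <;> omega
    · have := succAbove_val p z'
      simp only [Fin.le_def, Fin.lt_def, Fin.val_castSucc] at *
      split_ifs at this <;> omega
  by_cases hpi : p ≤ i
  · by_cases hje : j = y
    · right; exact ⟨hpi, hilast, hje.symm⟩
    · left
      have hjy' : j < y := lt_of_le_of_ne hjy hje
      have : ∃ x : Fin (n+1), x ≠ p ∧ j ≤ σ x ∧ (x : ℕ) ≤ i + 1 := by
        by_contra! hc
        have hc' : ∀ x : Fin (n+1), x ≠ p → (x : ℕ) ≤ i + 1 → σ x < j := by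
          intro x hx hxi
          by_contra hn
          have := hc x hx (not_lt.1 hn)
          omega
        have : ∃ c, c ≤ y ∧ c ≠ p ∧ j ≤ σ c := by
          by_contra! hn
          exact pigeon σ p y j (by order) hjy' hn
        obtain ⟨c, hcy, hcp, hjc⟩ := this
        have hcy' : c < y := by
          refine lt_of_le_of_ne hcy ?_
          rintro rfl
          order
        have hci : (i : ℕ) + 1 < c := by
          by_contra hn
          have := hc' c hcp (by omega)
          order
        have hbn : (i : ℕ) + 1 < n + 1 := by omega
        set b : Fin (n+1) := ⟨(i : ℕ) + 1, hbn⟩ with hb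
        have hib : i < b := by rw [Fin.lt_def]; simp [hb]
        have hbc : b < c := by rw [Fin.lt_def]; simpa [hb] using hci
        have hall : ∀ x, p < x → x ≤ b → σ x < σ y := by
          intro x hpx hxb
          by_contra hn
          have hne : σ x ≠ σ y := fun e => by
            have := σ.injective e
            order
          have h1 : σ x < j := hc' x (ne_of_gt hpx) (by simpa [Fin.le_def, hb] using hxb)
          exact h42 ⟨p, x, c, y, hpx, by order, hcy', by order, by order, hltp c hcp⟩
        have hall2 : ∀ x, x < p → σ x < σ y := by
          intro x hxp
          by_contra hn
          have hne : σ x ≠ σ y := fun e => by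
            have := σ.injective e
            order
          exact h34 ⟨x, p, b, y, hxp, by order, by order, hall b (by order) le_rfl, by order,
            hltp x (ne_of_lt hxp)⟩
        refine pigeon σ p b (σ y) (by order) (by order) ?_
        intro x hx hxp
        rcases lt_or_gt_of_ne hxp with h1 | h1
        · exact hall2 x h1
        · exact hall x h1 hx
      obtain ⟨x, h1, h2, h3⟩ := this
      exact mk x y h1 hyp h2 hgi (Or.inr ⟨hpi, h3⟩) (Or.inr hjy')
  · left
    have hx0p : x0 ≠ p := by rintro rfl; order
    by_cases hje : j = y
    · by_cases hyp' : y < p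
      · exact mk x0 y hx0p hyp hx1 hgi (Or.inl hx0) (Or.inl ⟨hjy, hyp'⟩)
      · exfalso
        have hpy : p < y := by order
        have hs : Finset.univ.filter (fun z => σ z < σ x0) ⊆
            ((Finset.univ.filter (fun z => z ≤ y)).erase p).erase x0 := by
          intro z
          simp only [Finset.mem_filter, Finset.mem_univ, true_and, Finset.mem_erase]
          intro hz
          refine ⟨?_, ?_, ?_⟩
          · rintro rfl; order
          · rintro rfl; have := hltp x0 hx0p; order
          · by_contra hn
            have hiz : i < σ z := by
              by_contra hn'
              have := hgm z (not_lt.1 hn')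
              order
            exact h34 ⟨x0, p, y, z, by order, hpy, by order, by order, hz, hltp x0 hx0p⟩
        have := Finset.card_le_card hs
        rw [Finset.card_erase_of_mem, Finset.card_erase_of_mem, card_pos_le, card_val_lt] at this
        · simp only [Fin.le_def, Fin.lt_def] at *
          have : (j:ℕ) = y := by rw [hje]
          omega
        · simp; order
        · simp only [Finset.mem_filter, Finset.mem_univ, true_and, Finset.mem_erase]
          exact ⟨hx0p, by order⟩
    · exact mk x0 y hx0p hyp hx1 hgi (Or.inl hx0) (Or.inr (by order))

theorem Del.avoid {n : ℕ} {σ : Equiv.Perm (Fin (n + 1))} {p : Fin (n + 1)}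
    {σ' : Equiv.Perm (Fin n)} (h : Del σ p σ') (h42 : avoids4231 σ) (h34 : covexillary σ) :
    avoids4231 σ' ∧ covexillary σ' := by
  have hm : ∀ a b : Fin n, a < b → p.succAbove a < p.succAbove b := by
    intro a b hab; simpa using hab
  have hv : ∀ a b : Fin n, σ' a < σ' b → σ (p.succAbove a) < σ (p.succAbove b) := by
    intro a b hab; rw [← h.del, ← h.del]; simpa using hab
  constructor
  · rintro ⟨a, b, c, d, h1, h2, h3, h4, h5, h6⟩
    exact h42 ⟨_, _, _, _, hm _ _ h1, hm _ _ h2, hm _ _ h3, hv _ _ h4, hv _ _ h5, hv _ _ h6⟩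
  · rintro ⟨a, b, c, d, h1, h2, h3, h4, h5, h6⟩
    exact h34 ⟨_, _, _, _, hm _ _ h1, hm _ _ h2, hm _ _ h3, hv _ _ h4, hv _ _ h5, hv _ _ h6⟩

theorem le_inv : ∀ (n : ℕ) (σ : Equiv.Perm (Fin n)), avoids4231 σ → covexillary σ →
    (prs σ).card ≤ invNum σ := by
  intro n
  induction n with
  | zero => intro σ _ _; simp [prs]
  | succ n ih =>
    intro σ h42 h34
    obtain ⟨p, σ', h⟩ := exists_del σ
    obtain ⟨g, hg⟩ := exists_g σ
    have h1 := h.inv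
    have h2 := Finset.card_le_card (h.subset_union hg h42 h34)
    rw [h.union_card hg] at h2
    have := ih σ' (h.avoid h42 h34).1 (h.avoid h42 h34).2
    omega

/-! ### Symmetries -/

theorem prs_symm {n : ℕ} (σ : Equiv.Perm (Fin n)) : prs σ.symm = prs σ := by
  have key : ∀ σ : Equiv.Perm (Fin n), prs σ.symm ⊆ prs σ := by
    intro σ
    rintro ⟨i, j⟩ h
    rw [mem_prs] at *
    obtain ⟨h1, ⟨x, h2, h3⟩, y, h4, h5⟩ := h
    exact ⟨h1, ⟨σ.symm y, h5, by simpa using h4⟩, σ.symm x, h3, by simpa using h2⟩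
  exact (key σ).antisymm (by simpa using key σ.symm)

theorem inv_symm {n : ℕ} (σ : Equiv.Perm (Fin n)) : invNum σ.symm = invNum σ := by
  unfold invNum
  refine Finset.card_equiv ((Equiv.prodComm _ _).trans (Equiv.prodCongr σ.symm σ.symm)) ?_
  rintro ⟨x, y⟩
  simp
  tauto

/-- The reverse-complement of `σ`. -/
def rc {n : ℕ} (σ : Equiv.Perm (Fin n)) : Equiv.Perm (Fin n) :=
  Fin.revPerm.trans (σ.trans Fin.revPerm)

theorem rc_apply {n : ℕ} (σ : Equiv.Perm (Fin n)) (x : Fin n) : rc σ x = (σ x.rev).rev := by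
  simp [rc]

theorem inv_rc {n : ℕ} (σ : Equiv.Perm (Fin n)) : invNum (rc σ) = invNum σ := by
  unfold invNum
  refine Finset.card_equiv ((Equiv.prodComm _ _).trans (Equiv.prodCongr Fin.revPerm Fin.revPerm)) ?_
  rintro ⟨x, y⟩
  simp [rc_apply]

theorem card_prs_rc {n : ℕ} (σ : Equiv.Perm (Fin n)) : (prs (rc σ)).card = (prs σ).card := by
  refine Finset.card_equiv ((Equiv.prodComm _ _).trans (Equiv.prodCongr Fin.revPerm Fin.revPerm)) ?_
  rintro ⟨x, y⟩
  have e : ∀ P : Fin n → Prop, (∃ x, P x) ↔ ∃ x : Fin n, P x.rev := fun P =>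
    ⟨fun ⟨x, h⟩ => ⟨x.rev, by simpa using h⟩, fun ⟨x, h⟩ => ⟨_, h⟩⟩
  simp only [mem_prs, rc_apply, Equiv.trans_apply, Equiv.prodComm_apply, Prod.swap,
    Equiv.prodCongr_apply, Prod.map, Fin.revPerm_apply]
  rw [e (fun z => z ≤ x ∧ _), e (fun z => y ≤ z ∧ _)]
  simp only [Fin.rev_rev, Fin.rev_lt_rev, Fin.le_rev_iff, Fin.rev_le_iff]
  tauto

/-- Positions `a b c d` form a pattern 4231 or 3412. -/
def pat {n : ℕ} (σ : Equiv.Perm (Fin n)) (a b c d : Fin n) : Prop :=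
  a < b ∧ b < c ∧ c < d ∧
    ((σ d < σ b ∧ σ b < σ c ∧ σ c < σ a) ∨ (σ c < σ d ∧ σ d < σ a ∧ σ a < σ b))

/-- Lemma for the extremal 3412 pattern. -/
theorem strict_extra {n : ℕ} (σ : Equiv.Perm (Fin (n + 1))) (b c : Fin (n + 1))
    (hb : σ b = Fin.last n) (hc : σ c = 0) (h0 : 0 < b) (hbc : b < c) (hu : c ≤ σ 0) :
    invNum σ < (prs σ).card := by
  obtain ⟨p, σ', h⟩ := exists_del σ
  obtain ⟨g, hg⟩ := exists_g σ
  have hpb : p = b := σ.injective (h.last.trans hb.symm)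
  subst hpb
  have hlt : (oldPrs σ' ∪ newPrs p g).card < (prs σ).card := by
    refine Finset.card_lt_card ((Finset.ssubset_iff_of_subset (h.union_subset hg)).2
      ⟨(0, c), ?_, ?_⟩)
    · rw [mem_prs]
      exact ⟨h0.trans hbc, ⟨0, le_rfl, hu⟩, c, le_rfl, hc.le⟩
    · rw [Finset.mem_union, mem_oldPrs, mem_newPrs]
      rintro (⟨i, j, h1, h2, h3⟩ | ⟨h1, -⟩)
      · rw [mem_prs] at h1
        obtain ⟨-, -, y, h4, h5⟩ := h1
        have h6 : σ (p.succAbove y) = 0 := by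
          rw [← h.del, ← nonpos_iff_eq_zero, ← h2]; simpa using h5
        have h7 := σ.injective (h6.trans hc.symm)
        have := succAbove_val p y
        rw [h7, ← h3] at this
        rw [← h3] at hbc
        simp only [Fin.le_def, Fin.lt_def, Fin.val_castSucc] at *
        split_ifs at this <;> omega
      · order
  rw [h.union_card hg] at hlt
  have := h.inv
  have := inv_le n σ'
  omega

theorem strict : ∀ (n : ℕ) (σ : Equiv.Perm (Fin n)) (a b c d : Fin n), pat σ a b c d →
    invNum σ < (prs σ).card := by
  intro n
  induction n with
  | zero => intro σ a; exact a.elim0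
  | succ n ih =>
    -- a pattern not using the last value
    have D : ∀ (σ : Equiv.Perm (Fin (n+1))) (a b c d : Fin (n+1)), pat σ a b c d →
        σ a ≠ Fin.last n → σ b ≠ Fin.last n → invNum σ < (prs σ).card := by
      intro σ a b c d hpat ha hb
      obtain ⟨p, σ', h⟩ := exists_del σ
      have hne : ∀ x, σ x ≠ Fin.last n → x ≠ p := by
        rintro x hx rfl; exact hx h.last
      have hcc : σ c ≠ Fin.last n ∧ σ d ≠ Fin.last n := by
        obtain ⟨-, -, -, h4 | h4⟩ := hpat
        · have := Fin.le_last (σ a)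
          constructor <;> intro e <;> order
        · have := Fin.le_last (σ b)
          constructor <;> intro e <;> order
      obtain ⟨a, rfl⟩ := Fin.exists_succAbove_eq (hne a ha)
      obtain ⟨b, rfl⟩ := Fin.exists_succAbove_eq (hne b hb)
      obtain ⟨c, rfl⟩ := Fin.exists_succAbove_eq (hne c hcc.1)
      obtain ⟨d, rfl⟩ := Fin.exists_succAbove_eq (hne d hcc.2)
      have h1 : pat σ' a b c d := by
        unfold pat at *
        simp only [← h.del] at hpat
        simpa using hpat
      have := ih σ' a b c d h1
      have := h.inv
      have := h.card_ge
      omega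
    -- a pattern not using the last value or the last position
    have D2 : ∀ (σ : Equiv.Perm (Fin (n+1))) (a b c d : Fin (n+1)), pat σ a b c d →
        (σ a ≠ Fin.last n ∧ σ b ≠ Fin.last n) ∨ d ≠ Fin.last n → invNum σ < (prs σ).card := by
      intro σ a b c d hpat hh
      rcases hh with ⟨ha, hb⟩ | hd
      · exact D σ a b c d hpat ha hb
      · rw [← inv_symm, ← prs_symm]
        have hl := Fin.le_last d
        obtain ⟨h1, h2, h3, h4 | h4⟩ := hpat
        · refine D σ.symm (σ d) (σ b) (σ c) (σ a) ?_ ?_ ?_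
          · refine ⟨h4.1, h4.2.1, h4.2.2, Or.inl ?_⟩
            simp [h1, h2, h3]
          · simpa using hd
          · simp only [Equiv.symm_apply_apply]; intro e; order
        · refine D σ.symm (σ c) (σ d) (σ a) (σ b) ?_ ?_ ?_
          · refine ⟨h4.1, h4.2.1, h4.2.2, Or.inr ?_⟩
            simp [h1, h2, h3]
          · simp only [Equiv.symm_apply_apply]; intro e; order
          · simpa using hd
    intro σ a b c d hpat
    by_contra hcon
    have hA : d = Fin.last n ∧ (σ a = Fin.last n ∨ σ b = Fin.last n) := by
      have := mt (D2 σ a b c d hpat) hcon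
      tauto
    have hB : a = 0 ∧ (σ d = 0 ∨ σ c = 0) := by
      have hp : pat (rc σ) d.rev c.rev b.rev a.rev := by
        obtain ⟨h1, h2, h3, h4⟩ := hpat
        refine ⟨by simpa using h3, by simpa using h2, by simpa using h1, ?_⟩
        simp only [rc_apply, Fin.rev_rev, Fin.rev_lt_rev]
        tauto
      have := mt (D2 (rc σ) _ _ _ _ hp) (by rwa [inv_rc, card_prs_rc])
      simp only [rc_apply, Fin.rev_rev, ne_eq, Fin.rev_eq_iff, Fin.rev_last] at this
      tauto
    obtain ⟨rfl, hA⟩ := hA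
    obtain ⟨rfl, hB⟩ := hB
    obtain ⟨h1, h2, h3, h4 | h4⟩ := hpat
    · have ha : σ 0 = Fin.last n := by
        rcases hA with h | h
        · exact h
        · have := Fin.le_last (σ 0); order
      have hd : σ (Fin.last n) = 0 := by
        rcases hB with h | h
        · exact h
        · have := Fin.zero_le (σ (Fin.last n)); order
      apply hcon
      refine Finset.card_lt_card ((Finset.ssubset_iff_of_subset ?_).2 ⟨(b, c), ?_, ?_⟩)
      · rintro ⟨x, y⟩ h
        simp only [Finset.mem_filter, Finset.mem_univ, true_and] at h
        rw [mem_prs]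
        exact ⟨h.1, ⟨0, Fin.zero_le _, by rw [ha]; exact Fin.le_last _⟩,
          Fin.last n, Fin.le_last _, by rw [hd]; exact Fin.zero_le _⟩
      · rw [mem_prs]
        exact ⟨h2, ⟨0, Fin.zero_le _, by rw [ha]; exact Fin.le_last _⟩,
          Fin.last n, Fin.le_last _, by rw [hd]; exact Fin.zero_le _⟩
      · simp only [Finset.mem_filter, Finset.mem_univ, true_and, not_and, not_lt]
        intro _; order
    · have hb : σ b = Fin.last n := by
        rcases hA with h | h
        · have := Fin.le_last (σ b); order
        · exact h
      have hc : σ c = 0 := by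
        rcases hB with h | h
        · have := Fin.zero_le (σ c); order
        · exact h
      apply hcon
      rcases le_total c (σ 0) with hu | hu
      · exact strict_extra σ b c hb hc h1 h2 hu
      · rw [← inv_symm, ← prs_symm]
        refine strict_extra σ.symm (σ (Fin.last n)) (σ 0) (by simp) (by simp) ?_ h4.2.1 ?_
        · rw [← hc]; exact h4.1
        · have : σ.symm 0 = c := by rw [← hc]; simp
          rw [this]; exact hu

/-- σ is smooth iff σ avoids 4231 and 3412. -/
theorem smooth_iff_avoids (n : ℕ) (σ : Equiv.Perm (Fin n)) :
    smooth σ ↔ avoids4231 σ ∧ covexillary σ := by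
  unfold smooth
  rw [card_below]
  constructor
  · intro h
    constructor
    · rintro ⟨a, b, c, d, h1, h2, h3, h4⟩
      exact absurd h (strict n σ a b c d ⟨h1, h2, h3, Or.inl h4⟩).ne
    · rintro ⟨a, b, c, d, h1, h2, h3, h4⟩
      exact absurd h (strict n σ a b c d ⟨h1, h2, h3, Or.inr h4⟩).ne
  · rintro ⟨h1, h2⟩
    exact (inv_le n σ).antisymm (le_inv n σ h1 h2)

end SmoothPerm
end

section
/- The map σ ↦ C(σ) is a bijection between the smooth permutations of S_n and the admissible subsets of C^{2,3}. -/
namespace SmoothPerm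

variable {n : ℕ}

/-- `F σ a b` says `max σ([0..a]) ≥ b`. -/
def F (σ : Equiv.Perm (Fin n)) (a b : ℕ) : Prop := ∃ x : Fin n, (x : ℕ) ≤ a ∧ b ≤ (σ x : ℕ)

lemma F_lt {σ : Equiv.Perm (Fin n)} {a b : ℕ} (h : F σ a b) : b < n := by
  obtain ⟨x, _, h⟩ := h
  exact lt_of_le_of_lt h (σ x).2

lemma F_mono {σ : Equiv.Perm (Fin n)} {a b a' b' : ℕ} (h : F σ a b) (ha : a ≤ a') (hb : b' ≤ b) :
    F σ a' b' := by
  obtain ⟨x, h1, h2⟩ := h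
  exact ⟨x, by omega, by omega⟩

/-- pigeonhole -/
lemma pigeon_s11 (σ : Equiv.Perm (Fin n)) (P V : Finset (Fin n)) (h : V.card < P.card) :
    ∃ x ∈ P, σ x ∉ V := by
  by_contra hc
  push Not at hc
  have := Finset.card_le_card_of_injOn (s := P) (t := V) σ (fun x hx => hc x hx)
    (σ.injective.injOn)
  omega

lemma F_of_le (σ : Equiv.Perm (Fin n)) {a b : ℕ} (h : b ≤ a) (hb : b < n) : F σ a b := by
  obtain ⟨x, hx, hx'⟩ := pigeon_s11 σ (Finset.Iic ⟨b, hb⟩) (Finset.Iio ⟨b, hb⟩) (by simp)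
  simp at hx hx'
  refine ⟨x, ?_, ?_⟩
  · have : (x : ℕ) ≤ b := hx
    omega
  · exact hx'

lemma F_cut (σ : Equiv.Perm (Fin n)) {a : ℕ} (h : F σ a (a + 1)) : F σ⁻¹ a (a + 1) := by
  by_contra hc
  have han : a < n := by have := F_lt h; omega
  obtain ⟨y, hy, hy'⟩ := h
  obtain ⟨v, hv, hv'⟩ := pigeon_s11 σ⁻¹ (Finset.Iic ⟨a, han⟩) ((Finset.Iic ⟨a, han⟩).erase y) (by
    apply Finset.card_erase_lt_of_mem
    rw [Finset.mem_Iic]; exact hy)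
  simp at hv hv'
  have hv1 : (v : ℕ) ≤ a := hv
  apply hc
  refine ⟨v, hv1, ?_⟩
  have : σ⁻¹ v ≠ y := by
    rintro rfl
    simp at hy'
    omega
  exact hv' this


def Thin (τ : Equiv.Perm (Fin n)) : Prop :=
  ∀ p x y : Fin n, x ≤ p → y ≤ p → p < τ x → p < τ y → x = y

def rk (σ : Equiv.Perm (Fin n)) (i j : Fin n) : ℕ :=
  (Finset.univ.filter (fun x => x ≤ i ∧ σ x ≤ j)).card

lemma rk_inv (σ : Equiv.Perm (Fin n)) (i j : Fin n) : rk σ⁻¹ i j = rk σ j i := by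
  unfold rk
  apply Finset.card_bij' (fun x _ => σ⁻¹ x) (fun x _ => σ x) <;> simp <;> tauto

lemma bruhat_inv {τ σ : Equiv.Perm (Fin n)} : bruhatLE τ⁻¹ σ⁻¹ ↔ bruhatLE τ σ := by
  have h : ∀ τ σ : Equiv.Perm (Fin n), bruhatLE τ σ → bruhatLE τ⁻¹ σ⁻¹ := by
    intro τ σ h i j
    have := h j i
    have h1 := rk_inv σ i j
    have h2 := rk_inv τ i j
    unfold rk at h1 h2
    omega
  exact ⟨fun hh => by simpa using h _ _ hh, h _ _⟩

lemma bruhat_trans {a b c : Equiv.Perm (Fin n)} (h : bruhatLE a b) (h' : bruhatLE b c) :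
    bruhatLE a c := fun i j => (h' i j).trans (h i j)

lemma rk_add (σ : Equiv.Perm (Fin n)) (i j : Fin n) :
    rk σ i j + (Finset.univ.filter (fun x => x ≤ i ∧ j < σ x)).card = i + 1 := by
  have h := Finset.card_filter_add_card_filter_not (s := Finset.Iic i) (fun x => σ x ≤ j)
  rw [Fin.card_Iic] at h
  rw [← h]
  unfold rk
  congr 2 <;> ext x <;> simp

lemma rk_eq_iff (σ : Equiv.Perm (Fin n)) (i j : Fin n) :
    rk σ i j = i + 1 ↔ ¬ F σ i (j + 1) := by
  have h := rk_add σ i j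
  have : rk σ i j = i + 1 ↔ (Finset.univ.filter (fun x => x ≤ i ∧ j < σ x)).card = 0 := by omega
  rw [this, Finset.card_eq_zero, Finset.filter_eq_empty_iff]
  unfold F
  push Not
  constructor
  · intro h x hx
    have := h (Finset.mem_univ x)
    by_contra hc
    grind
  · intro h x _
    have := h x
    grind

lemma thin_rk {τ : Equiv.Perm (Fin n)} (h : Thin τ) {i j : Fin n} (hij : i ≤ j) :
    (i : ℕ) ≤ rk τ i j := by
  have h1 := rk_add τ i j
  have : (Finset.univ.filter (fun x => x ≤ i ∧ j < τ x)).card ≤ 1 := by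
    rw [Finset.card_le_one]
    simp only [Finset.mem_filter, Finset.mem_univ, true_and]
    rintro a ⟨ha, ha'⟩ b ⟨hb, hb'⟩
    exact h i a b ha hb (lt_of_le_of_lt hij ha') (lt_of_le_of_lt hij hb')
  omega

lemma thin_half {τ σ : Equiv.Perm (Fin n)} (h : Thin τ)
    (hF : ∀ a b, a < b → F τ a b → F σ a b) {i j : Fin n} (hij : i ≤ j) : rk σ i j ≤ rk τ i j := by
  have h1 := thin_rk h hij
  have h2 := rk_eq_iff τ i j
  have h3 := rk_eq_iff σ i j
  have h4 := rk_add σ i j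
  have h6 := rk_add τ i j
  have h5 := hF i (j + 1) (by have : (i:ℕ) ≤ j := hij
                              omega)
  by_cases hc : rk σ i j = i + 1
  · have : ¬ F τ i (j + 1) := fun hh => (h3.1 hc) (h5 hh)
    have := h2.2 this
    omega
  · omega

lemma thin_half' {τ σ : Equiv.Perm (Fin n)} (hF : ∀ i j : Fin n, i ≤ j → rk σ i j ≤ rk τ i j)
    (a b : ℕ) (hab : a < b) (h : F τ a b) : F σ a b := by
  have hb := F_lt h
  obtain ⟨b, rfl⟩ : ∃ c, b = c + 1 := ⟨b - 1, by omega⟩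
  have h1 := hF ⟨a, by omega⟩ ⟨b, by omega⟩ (by rw [Fin.le_def]; simp; omega)
  have h2 := rk_eq_iff τ ⟨a, by omega⟩ ⟨b, by omega⟩
  have h3 := rk_eq_iff σ ⟨a, by omega⟩ ⟨b, by omega⟩
  have h4 := rk_add τ ⟨a, by omega⟩ ⟨b, by omega⟩
  simp only at h2 h3 h4
  by_contra hc
  have := h3.2 hc
  exact (h2.1 (by omega)) h

lemma thin_bruhat {τ σ : Equiv.Perm (Fin n)} (h : Thin τ) (h' : Thin τ⁻¹) :
    bruhatLE τ σ ↔ (∀ a b, a < b → F τ a b → F σ a b) ∧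
      (∀ a b, a < b → F τ⁻¹ a b → F σ⁻¹ a b) := by
  constructor
  · intro hb
    refine ⟨thin_half' fun i j _ => hb i j, thin_half' fun i j _ => ?_⟩
    rw [rk_inv, rk_inv]
    exact hb j i
  · rintro ⟨h1, h2⟩ i j
    rcases le_total i j with hij | hij
    · exact thin_half h h1 hij
    · have := thin_half h' h2 hij
      rwa [rk_inv, rk_inv] at this

lemma thin_swap {i j : Fin n} (hij : i < j) : Thin (Equiv.swap i j) := by
  intro p x y
  simp only [Equiv.swap_apply_def]
  grind

lemma Rc_apply {i j k : Fin n} (hij : i < j) (hjk : j < k) (x : Fin n) :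
    Rc i j k x = if x = i then j else if x = j then k else if x = k then i else x := by
  simp only [Rc, Equiv.Perm.mul_apply, Equiv.swap_apply_def]
  grind

lemma Lc_apply {i j k : Fin n} (hij : i < j) (hjk : j < k) (x : Fin n) :
    Lc i j k x = if x = i then k else if x = j then i else if x = k then j else x := by
  unfold Lc
  rw [Equiv.Perm.inv_eq_iff_eq, Rc_apply hij hjk]
  grind

lemma thin_Rc {i j k : Fin n} (hij : i < j) (hjk : j < k) : Thin (Rc i j k) := by
  intro p x y
  rw [Rc_apply hij hjk, Rc_apply hij hjk]
  grind

lemma thin_Lc {i j k : Fin n} (hij : i < j) (hjk : j < k) : Thin (Lc i j k) := by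
  intro p x y
  rw [Lc_apply hij hjk, Lc_apply hij hjk]
  grind

lemma F_swap {i j : Fin n} (hij : i < j) {a b : ℕ} (hab : a < b) :
    F (Equiv.swap i j) a b ↔ (i : ℕ) ≤ a ∧ b ≤ j := by
  unfold F
  simp only [Equiv.swap_apply_def]
  constructor
  · grind
  · intro h
    exact ⟨i, by grind⟩

lemma F_Rc {i j k : Fin n} (hij : i < j) (hjk : j < k) {a b : ℕ} (hab : a < b) :
    F (Rc i j k) a b ↔ ((i : ℕ) ≤ a ∧ b ≤ j) ∨ ((j : ℕ) ≤ a ∧ b ≤ k) := by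
  unfold F
  simp only [Rc_apply hij hjk]
  constructor
  · grind
  · rintro (h | h)
    · exact ⟨i, by grind⟩
    · exact ⟨j, by grind⟩

lemma F_Lc {i j k : Fin n} (hij : i < j) (hjk : j < k) {a b : ℕ} (hab : a < b) :
    F (Lc i j k) a b ↔ ((i : ℕ) ≤ a ∧ b ≤ k) := by
  unfold F
  simp only [Lc_apply hij hjk]
  constructor
  · grind
  · rintro h
    · exact ⟨i, by grind⟩

lemma Rc_inv (i j k : Fin n) : (Rc i j k)⁻¹ = Lc i j k := rfl
lemma Lc_inv (i j k : Fin n) : (Lc i j k)⁻¹ = Rc i j k := inv_inv _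

lemma swap_le {σ : Equiv.Perm (Fin n)} {i j : Fin n} (hij : i < j) :
    bruhatLE (Equiv.swap i j) σ ↔ F σ i j ∧ F σ⁻¹ i j := by
  rw [thin_bruhat (thin_swap hij) (by rw [Equiv.swap_inv]; exact thin_swap hij), Equiv.swap_inv]
  constructor
  · rintro ⟨h1, h2⟩
    exact ⟨h1 _ _ hij ((F_swap hij hij).2 (by simp)), h2 _ _ hij ((F_swap hij hij).2 (by simp))⟩
  · rintro ⟨h1, h2⟩
    constructor <;> intro a b hab h <;> rw [F_swap hij hab] at h
    · exact F_mono h1 h.1 h.2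
    · exact F_mono h2 h.1 h.2

lemma Rc_le {σ : Equiv.Perm (Fin n)} {i j k : Fin n} (hij : i < j) (hjk : j < k) :
    bruhatLE (Rc i j k) σ ↔ F σ i j ∧ F σ j k ∧ F σ⁻¹ i k := by
  rw [thin_bruhat (thin_Rc hij hjk) (by rw [Rc_inv]; exact thin_Lc hij hjk), Rc_inv]
  have hik := hij.trans hjk
  constructor
  · rintro ⟨h1, h2⟩
    exact ⟨h1 _ _ hij ((F_Rc hij hjk hij).2 (by simp)), h1 _ _ hjk ((F_Rc hij hjk hjk).2 (by simp)),
      h2 _ _ hik ((F_Lc hij hjk hik).2 (by simp))⟩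
  · rintro ⟨h1, h2, h3⟩
    constructor <;> intro a b hab h
    · rw [F_Rc hij hjk hab] at h
      rcases h with h | h
      · exact F_mono h1 h.1 h.2
      · exact F_mono h2 h.1 h.2
    · rw [F_Lc hij hjk hab] at h
      exact F_mono h3 h.1 h.2

lemma Lc_le {σ : Equiv.Perm (Fin n)} {i j k : Fin n} (hij : i < j) (hjk : j < k) :
    bruhatLE (Lc i j k) σ ↔ F σ⁻¹ i j ∧ F σ⁻¹ j k ∧ F σ i k := by
  rw [← bruhat_inv, Lc_inv, Rc_le hij hjk, inv_inv]



@[ext]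
structure Tab where
  t : ℕ → ℕ → Prop
  r : ℕ → ℕ → ℕ → Prop
  l : ℕ → ℕ → ℕ → Prop

def Tab.inv (T : Tab) : Tab := ⟨T.t, T.l, T.r⟩

def tabA (A : Set (Equiv.Perm (Fin n))) : Tab where
  t i j := ∃ (hi : i < n) (hj : j < n), i < j ∧ Equiv.swap (⟨i, hi⟩ : Fin n) ⟨j, hj⟩ ∈ A
  r i j k := ∃ (hi : i < n) (hj : j < n) (hk : k < n), i < j ∧ j < k ∧
    Rc (⟨i, hi⟩ : Fin n) ⟨j, hj⟩ ⟨k, hk⟩ ∈ A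
  l i j k := ∃ (hi : i < n) (hj : j < n) (hk : k < n), i < j ∧ j < k ∧
    Lc (⟨i, hi⟩ : Fin n) ⟨j, hj⟩ ⟨k, hk⟩ ∈ A

def tabP (σ : Equiv.Perm (Fin n)) : Tab where
  t i j := i < j ∧ F σ i j ∧ F σ⁻¹ i j
  r i j k := i < j ∧ j < k ∧ F σ i j ∧ F σ j k ∧ F σ⁻¹ i k
  l i j k := i < j ∧ j < k ∧ F σ⁻¹ i j ∧ F σ⁻¹ j k ∧ F σ i k

lemma tabP_inv (σ : Equiv.Perm (Fin n)) : tabP σ⁻¹ = (tabP σ).inv := by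
  ext <;> simp [tabP, Tab.inv] <;> tauto

lemma swap_inC {i j : Fin n} (h : i < j) : inC23 (Equiv.swap i j) := Or.inl ⟨i, j, h, rfl⟩
lemma Rc_inC {i j k : Fin n} (h : i < j) (h' : j < k) : inC23 (Rc i j k) :=
  Or.inr ⟨i, j, k, h, h', Or.inl rfl⟩
lemma Lc_inC {i j k : Fin n} (h : i < j) (h' : j < k) : inC23 (Lc i j k) :=
  Or.inr ⟨i, j, k, h, h', Or.inr rfl⟩

lemma tabA_Ctab (σ : Equiv.Perm (Fin n)) : tabA (Ctab σ) = tabP σ := by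
  ext i j k
  · simp only [tabA, tabP, Ctab, Set.mem_ofPred_eq]
    constructor
    · rintro ⟨hi, hj, h, -, hb⟩
      exact ⟨h, (swap_le (i := ⟨i, hi⟩) (j := ⟨j, hj⟩) h).1 hb⟩
    · rintro ⟨h, h1, h2⟩
      have hj := F_lt h1
      have h' : (⟨i, h.trans hj⟩ : Fin n) < ⟨j, hj⟩ := h
      exact ⟨h.trans hj, hj, h, swap_inC h', (swap_le h').2 ⟨h1, h2⟩⟩
  · simp only [tabA, tabP, Ctab, Set.mem_ofPred_eq]
    constructor
    · rintro ⟨hi, hj, hk, h, h', -, hb⟩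
      exact ⟨h, h', (Rc_le (i := ⟨i, hi⟩) (j := ⟨j, hj⟩) (k := ⟨k, hk⟩) h h').1 hb⟩
    · rintro ⟨h, h', h1, h2, h3⟩
      have hj := F_lt h1
      have hk := F_lt h2
      have hi := h.trans hj
      have g : (⟨i, hi⟩ : Fin n) < ⟨j, hj⟩ := h
      have g' : (⟨j, hj⟩ : Fin n) < ⟨k, hk⟩ := h'
      exact ⟨hi, hj, hk, h, h', Rc_inC g g', (Rc_le g g').2 ⟨h1, h2, h3⟩⟩
  · simp only [tabA, tabP, Ctab, Set.mem_ofPred_eq]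
    constructor
    · rintro ⟨hi, hj, hk, h, h', -, hb⟩
      exact ⟨h, h', (Lc_le (i := ⟨i, hi⟩) (j := ⟨j, hj⟩) (k := ⟨k, hk⟩) h h').1 hb⟩
    · rintro ⟨h, h', h1, h2, h3⟩
      have hj := F_lt h1
      have hk := F_lt h2
      have hi := h.trans hj
      have g : (⟨i, hi⟩ : Fin n) < ⟨j, hj⟩ := h
      have g' : (⟨j, hj⟩ : Fin n) < ⟨k, hk⟩ := h'
      exact ⟨hi, hj, hk, h, h', Lc_inC g g', (Lc_le g g').2 ⟨h1, h2, h3⟩⟩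

lemma tabA_sub {A B : Set (Equiv.Perm (Fin n))} (hA : ∀ τ ∈ A, inC23 τ)
    (h : tabA A = tabA B) : A ⊆ B := by
  intro τ hτ
  rcases hA τ hτ with ⟨i, j, hij, rfl⟩ | ⟨i, j, k, hij, hjk, rfl | rfl⟩
  · have : (tabA A).t i j := ⟨i.2, j.2, hij, hτ⟩
    rw [h] at this
    obtain ⟨_, _, _, h⟩ := this
    exact h
  · have : (tabA A).r i j k := ⟨i.2, j.2, k.2, hij, hjk, hτ⟩
    rw [h] at this
    obtain ⟨_, _, _, _, _, h⟩ := this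
    exact h
  · have : (tabA A).l i j k := ⟨i.2, j.2, k.2, hij, hjk, hτ⟩
    rw [h] at this
    obtain ⟨_, _, _, _, _, h⟩ := this
    exact h

def Dn (T : Tab) (f g : ℕ → ℕ → Prop) : Prop :=
  (∀ a b, a < b → f a b → g a b → T.t a b) ∧
  (∀ a b c, a < b → b < c → f a b → f b c → g a c → T.r a b c) ∧
  (∀ a b c, a < b → b < c → g a b → g b c → f a c → T.l a b c)

def fT (i j a b : ℕ) : Prop := i ≤ a ∧ b ≤ j
def fR (i j k a b : ℕ) : Prop := (i ≤ a ∧ b ≤ j) ∨ (j ≤ a ∧ b ≤ k)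

structure Adm (n : ℕ) (T : Tab) : Prop where
  t_lt : ∀ i j, T.t i j → i < j ∧ j < n
  r_lt : ∀ i j k, T.r i j k → i < j ∧ j < k ∧ k < n
  l_lt : ∀ i j k, T.l i j k → i < j ∧ j < k ∧ k < n
  dT : ∀ i j, T.t i j → Dn T (fT i j) (fT i j)
  dR : ∀ i j k, T.r i j k → Dn T (fR i j k) (fT i k)
  dL : ∀ i j k, T.l i j k → Dn T (fT i k) (fR i j k)
  c3 : ∀ i j k l, T.r i j l → T.l i k l → T.t i l
  c4 : ∀ i j k, T.t i j → T.t j k → T.r i j k ∨ T.l i j k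

lemma Dn_inv {T : Tab} {f g : ℕ → ℕ → Prop} (h : Dn T f g) : Dn T.inv g f := by
  obtain ⟨h1, h2, h3⟩ := h
  refine ⟨fun a b hab hf hg => h1 a b hab hg hf, ?_, ?_⟩
  · intro a b c hab hbc x y z
    exact h3 a b c hab hbc x y z
  · intro a b c hab hbc x y z
    exact h2 a b c hab hbc x y z

lemma Adm.inv {T : Tab} (h : Adm n T) : Adm n T.inv where
  t_lt := h.t_lt
  r_lt := h.l_lt
  l_lt := h.r_lt
  dT i j hh := Dn_inv (h.dT i j hh)
  dR i j k hh := Dn_inv (h.dL i j k hh)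
  dL i j k hh := Dn_inv (h.dR i j k hh)
  c3 i j k l h1 h2 := h.c3 i k j l h2 h1
  c4 i j k h1 h2 := (h.c4 i j k h1 h2).symm

lemma Dn_of {A : Set (Equiv.Perm (Fin n))} (hA : admissible A) {e : Equiv.Perm (Fin n)}
    (he : e ∈ A) {f g : ℕ → ℕ → Prop} (hf : ∀ a b, a < b → f a b → F e a b)
    (hg : ∀ a b, a < b → g a b → F e⁻¹ a b) : Dn (tabA A) f g := by
  refine ⟨?_, ?_, ?_⟩
  · intro a b hab h1 h2
    have h1 := hf _ _ hab h1
    have h2 := hg _ _ hab h2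
    have hb := F_lt h1
    have g : (⟨a, hab.trans hb⟩ : Fin n) < ⟨b, hb⟩ := hab
    exact ⟨hab.trans hb, hb, hab, hA.2.1 e he _ (swap_inC g) ((swap_le g).2 ⟨h1, h2⟩)⟩
  · intro i j k h h' h1 h2 h3
    have h1 := hf _ _ h h1
    have h2 := hf _ _ h' h2
    have h3 := hg _ _ (h.trans h') h3
    have hj := F_lt h1
    have hk := F_lt h2
    have hi := h.trans hj
    have g : (⟨i, hi⟩ : Fin n) < ⟨j, hj⟩ := h
    have g' : (⟨j, hj⟩ : Fin n) < ⟨k, hk⟩ := h'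
    exact ⟨hi, hj, hk, h, h', hA.2.1 e he _ (Rc_inC g g') ((Rc_le g g').2 ⟨h1, h2, h3⟩)⟩
  · intro i j k h h' h1 h2 h3
    have h1 := hg _ _ h h1
    have h2 := hg _ _ h' h2
    have h3 := hf _ _ (h.trans h') h3
    have hj := F_lt h1
    have hk := F_lt h2
    have hi := h.trans hj
    have g : (⟨i, hi⟩ : Fin n) < ⟨j, hj⟩ := h
    have g' : (⟨j, hj⟩ : Fin n) < ⟨k, hk⟩ := h'
    exact ⟨hi, hj, hk, h, h', hA.2.1 e he _ (Lc_inC g g') ((Lc_le g g').2 ⟨h1, h2, h3⟩)⟩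

lemma adm_of {A : Set (Equiv.Perm (Fin n))} (hA : admissible A) : Adm n (tabA A) where
  t_lt := by rintro i j ⟨h1, h2, h3, h4⟩; exact ⟨h3, h2⟩
  r_lt := by rintro i j k ⟨h1, h2, h3, h4, h5, h6⟩; exact ⟨h4, h5, h3⟩
  l_lt := by rintro i j k ⟨h1, h2, h3, h4, h5, h6⟩; exact ⟨h4, h5, h3⟩
  dT := by
    rintro i j ⟨h1, h2, h3, h4⟩
    have g : (⟨i, h1⟩ : Fin n) < ⟨j, h2⟩ := h3
    refine Dn_of hA h4 ?_ ?_ <;> intro a b hab h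
    · exact (F_swap g hab).2 h
    · rw [Equiv.swap_inv]; exact (F_swap g hab).2 h
  dR := by
    rintro i j k ⟨h1, h2, h3, h4, h5, h6⟩
    have g : (⟨i, h1⟩ : Fin n) < ⟨j, h2⟩ := h4
    have g' : (⟨j, h2⟩ : Fin n) < ⟨k, h3⟩ := h5
    refine Dn_of hA h6 ?_ ?_ <;> intro a b hab h
    · exact (F_Rc g g' hab).2 h
    · rw [Rc_inv]; exact (F_Lc g g' hab).2 h
  dL := by
    rintro i j k ⟨h1, h2, h3, h4, h5, h6⟩
    have g : (⟨i, h1⟩ : Fin n) < ⟨j, h2⟩ := h4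
    have g' : (⟨j, h2⟩ : Fin n) < ⟨k, h3⟩ := h5
    refine Dn_of hA h6 ?_ ?_ <;> intro a b hab h
    · exact (F_Lc g g' hab).2 h
    · rw [Lc_inv]; exact (F_Rc g g' hab).2 h
  c3 := by
    rintro i j k l ⟨h1, h2, h3, h4, h5, h6⟩ ⟨_, h2', _, h4', h5', h6'⟩
    exact ⟨h1, h3, by omega, hA.2.2.1 _ _ _ _ h4 h5 h4' h5' h6 h6'⟩
  c4 := by
    rintro i j k ⟨h1, h2, h3, h4⟩ ⟨_, h2', h3', h4'⟩
    rcases hA.2.2.2 ⟨i, h1⟩ ⟨j, h2⟩ ⟨k, h2'⟩ h3 h3' h4 h4' with h | h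
    · exact Or.inl ⟨h1, h2, h2', h3, h3', h⟩
    · exact Or.inr ⟨h1, h2, h2', h3, h3', h⟩


structure Wedge (T : Tab) (i j : ℕ) : Prop where
  ht : T.t i j
  hmin : ∀ k l, k < i → ¬ T.t k l
  hr : ∀ k, ¬ T.r i j k

def Tab.der (T : Tab) (i j : ℕ) : Tab where
  t a b := T.t a b ∧ ¬ (a = i ∧ b = j)
  r a b c := T.r a b c ∧ ¬ (a = i ∧ c = j)
  l a b c := T.l a b c ∧ ¬ (a = i ∧ b = j)

section
variable {T : Tab} {i j : ℕ}

lemma Wedge.t_max (hA : Adm n T) (w : Wedge T i j) {k : ℕ} (h : T.t i k) : k ≤ j := by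
  by_contra hc
  have hij := hA.t_lt _ _ w.ht
  exact w.hr k ((hA.dT _ _ h).2.1 i j k (by omega) (by omega) ⟨by omega, by omega⟩
    ⟨by omega, by omega⟩ ⟨by omega, by omega⟩)

lemma Wedge.r_min (hA : Adm n T) (w : Wedge T i j) {a b c : ℕ} (h : T.r a b c) : i ≤ a := by
  by_contra hc
  have h1 := hA.r_lt _ _ _ h
  exact w.hmin a b (by omega) ((hA.dR _ _ _ h).1 a b (by omega) (by simp [fR])
    ⟨by omega, by omega⟩)

lemma Wedge.l_min (hA : Adm n T) (w : Wedge T i j) {a b c : ℕ} (h : T.l a b c) : i ≤ a := by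
  by_contra hc
  have h1 := hA.l_lt _ _ _ h
  exact w.hmin a b (by omega) ((hA.dL _ _ _ h).1 a b (by omega) 
    ⟨by omega, by omega⟩ (by simp [fR]))

lemma Wedge.r_max (hA : Adm n T) (w : Wedge T i j) {b c : ℕ} (h : T.r i b c) : c ≤ j := by
  by_contra hc
  have h1 := hA.r_lt _ _ _ h
  have hij := hA.t_lt _ _ w.ht
  have htjc : T.t j (j + 1) := by
    apply (hA.dR _ _ _ h).1 _ _ (by omega)
    · by_cases hb : b ≤ j
      · exact Or.inr ⟨hb, by omega⟩
      · exact Or.inl ⟨by omega, by omega⟩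
    · exact ⟨by omega, by omega⟩
  by_cases hb : j ≤ b
  · by_cases hb2 : b = j
    · subst hb2; exact w.hr _ h
    refine w.hr (j + 1) ((hA.dR _ _ _ h).2.1 i j (j + 1) (by omega) (by omega) (Or.inl ⟨by omega, by omega⟩)
      (Or.inl ⟨by omega, by omega⟩) ⟨by omega, by omega⟩)
  have hr : T.r i b (j + 1) := (hA.dR _ _ _ h).2.1 i b (j + 1) (by omega) (by omega)
    (Or.inl ⟨by omega, by omega⟩) (Or.inr ⟨by omega, by omega⟩) ⟨by omega, by omega⟩
  rcases hA.c4 _ _ _ w.ht htjc with h | h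
  · exact w.hr _ h
  · have := w.t_max hA (hA.c3 _ _ _ _ hr h)
    omega

lemma Wedge.l_max (hA : Adm n T) (w : Wedge T i j) {b c : ℕ} (h : T.l i b c) : b ≤ j := by
  have h1 := hA.l_lt _ _ _ h
  exact w.t_max hA ((hA.dL _ _ _ h).1 i b (by omega) ⟨by omega, by omega⟩ (by simp [fR]))

/-- Downward closure of the derived table, for a principal down-set. -/
lemma Dn_der {f g : ℕ → ℕ → Prop} (hD : Dn T f g)
    (h1 : ¬ (f i j ∧ g i j)) (h2 : ∀ b, i < b → b < j → ¬ (f i b ∧ f b j ∧ g i j))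
    (h3 : ∀ c, j < c → ¬ (g i j ∧ g j c ∧ f i c)) : Dn (T.der i j) f g := by
  obtain ⟨d1, d2, d3⟩ := hD
  refine ⟨?_, ?_, ?_⟩
  · intro a b hab hf hg
    refine ⟨d1 a b hab hf hg, ?_⟩
    rintro ⟨rfl, rfl⟩
    exact h1 ⟨hf, hg⟩
  · intro a b c hab hbc x y z
    refine ⟨d2 a b c hab hbc x y z, ?_⟩
    rintro ⟨rfl, rfl⟩
    exact h2 b hab hbc ⟨x, y, z⟩
  · intro a b c hab hbc x y z
    refine ⟨d3 a b c hab hbc x y z, ?_⟩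
    rintro ⟨rfl, rfl⟩
    exact h3 c hbc ⟨x, y, z⟩

lemma Adm.der (hA : Adm n T) (w : Wedge T i j) : Adm n (T.der i j) where
  t_lt a b h := hA.t_lt _ _ h.1
  r_lt a b c h := hA.r_lt _ _ _ h.1
  l_lt a b c h := hA.l_lt _ _ _ h.1
  dT := by
    rintro a b ⟨h, h'⟩
    have h0 := hA.t_lt _ _ h
    have h1 : i ≤ a := by
      by_contra hc
      exact w.hmin a b (by omega) h
    have h2 : a = i → b ≤ j := by rintro rfl; exact w.t_max hA h
    apply Dn_der (hA.dT _ _ h) <;> unfold fT <;> omega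
  dR := by
    rintro a b c ⟨h, h'⟩
    have h0 := hA.r_lt _ _ _ h
    have h1 := w.r_min hA h
    have h2 : a = i → c ≤ j := by rintro rfl; exact w.r_max hA h
    apply Dn_der (hA.dR _ _ _ h) <;> try simp only [fT, fR] 
    all_goals omega
  dL := by
    rintro a b c ⟨h, h'⟩
    have h0 := hA.l_lt _ _ _ h
    have h1 := w.l_min hA h
    have h2 : a = i → b ≤ j := by rintro rfl; exact w.l_max hA h
    apply Dn_der (hA.dL _ _ _ h) <;> try simp only [fT, fR] 
    all_goals omega
  c3 := by
    rintro a b c d ⟨h, h'⟩ ⟨g, g'⟩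
    exact ⟨hA.c3 _ _ _ _ h g, h'⟩
  c4 := by
    rintro a b c ⟨h, h'⟩ ⟨g, g'⟩
    by_cases hc : a = i ∧ c = j
    · right
      have h0 := hA.t_lt _ _ h
      have h1 := hA.t_lt _ _ g
      obtain ⟨rfl, rfl⟩ := hc
      exact ⟨(hA.dT _ _ w.ht).2.2 a b c (by omega) (by omega) ⟨by omega, by omega⟩
        ⟨by omega, by omega⟩ ⟨by omega, by omega⟩, by omega⟩
    · rcases hA.c4 _ _ _ h g with h1 | h1
      · exact Or.inl ⟨h1, hc⟩
      · exact Or.inr ⟨h1, h'⟩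

lemma wedge_exists (hA : Adm n T) (hne : ∃ a b, T.t a b) :
    ∃ i j, Wedge T i j ∨ Wedge T.inv i j := by
  classical
  set i := Nat.find hne with hi
  have hmin : ∀ k l, k < i → ¬ T.t k l := fun k l hk h => Nat.find_min hne hk ⟨l, h⟩
  have hex : ∃ b, T.t i b := Nat.find_spec hne
  have hb : ∀ b, T.t i b → b ≤ n := fun b h => (hA.t_lt _ _ h).2.le
  obtain ⟨b, hb'⟩ := hex
  have hspec : T.t i (Nat.findGreatest (fun b => T.t i b) n) :=
    Nat.findGreatest_spec (P := fun b => T.t i b) (hb b hb') hb'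
  have hmax : ∀ b, T.t i b → b ≤ Nat.findGreatest (fun b => T.t i b) n :=
    fun b h => Nat.le_findGreatest (hb b h) h
  set j := Nat.findGreatest (fun b => T.t i b) n
  have hij := hA.t_lt _ _ hspec
  refine ⟨i, j, ?_⟩
  by_contra hc
  push Not at hc
  obtain ⟨h1, h2⟩ := hc
  have hr : ∃ k, T.r i j k := by
    by_contra hh
    push Not at hh
    exact h1 ⟨hspec, hmin, hh⟩
  have hl : ∃ k, T.l i j k := by
    by_contra hh
    push Not at hh
    exact h2 ⟨hspec, hmin, hh⟩
  obtain ⟨k, hr⟩ := hr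
  obtain ⟨k', hl⟩ := hl
  have e1 := hA.r_lt _ _ _ hr
  have e2 := hA.l_lt _ _ _ hl
  have hr' : T.r i j (j + 1) := by
    apply (hA.dR _ _ _ hr).2.1 <;> try simp only [fR, fT]
    all_goals omega
  have hl' : T.l i j (j + 1) := by
    apply (hA.dL _ _ _ hl).2.2 <;> try simp only [fR, fT]
    all_goals omega
  have := hmax _ (hA.c3 _ _ _ _ hr' hl')
  omega

end



lemma F_inv_iff {σ : Equiv.Perm (Fin n)} {a b : ℕ} :
    F σ⁻¹ a b ↔ ∃ x : Fin n, b ≤ (x : ℕ) ∧ (σ x : ℕ) ≤ a := by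
  constructor
  · rintro ⟨v, h1, h2⟩
    exact ⟨σ⁻¹ v, h2, by simpa using h1⟩
  · rintro ⟨x, h1, h2⟩
    exact ⟨σ x, h2, by simpa using h1⟩

lemma mul_swap_apply (σ : Equiv.Perm (Fin n)) (m j x : Fin n) :
    (σ * Equiv.swap m j) x = if x = m then σ j else if x = j then σ m else σ x := by
  simp only [Equiv.Perm.mul_apply, Equiv.swap_apply_def]
  split_ifs <;> rfl

lemma step_F {σ : Equiv.Perm (Fin n)} {m j : Fin n} (hmj : (m : ℕ) + 1 = j) (h : σ j < σ m)
    {a b : ℕ} (hF : F (σ * Equiv.swap m j) a b) : F σ a b := by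
  obtain ⟨x, h1, h2⟩ := hF
  rw [mul_swap_apply] at h2
  split_ifs at h2 with e e
  · subst e; exact ⟨x, h1, by have : (σ j : ℕ) < σ x := h
                              omega⟩
  · subst e; exact ⟨m, by omega, h2⟩
  · exact ⟨x, h1, h2⟩

lemma step_G {σ : Equiv.Perm (Fin n)} {m j : Fin n} (hmj : (m : ℕ) + 1 = j) (h : σ j < σ m)
    {a b : ℕ} (hF : F (σ * Equiv.swap m j)⁻¹ a b) : F σ⁻¹ a b := by
  rw [F_inv_iff] at *
  obtain ⟨x, h1, h2⟩ := hF
  rw [mul_swap_apply] at h2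
  have h' : (σ j : ℕ) < σ m := h
  split_ifs at h2 with e e
  · subst e; exact ⟨j, by omega, h2⟩
  · subst e; exact ⟨x, by omega, by omega⟩
  · exact ⟨x, h1, h2⟩

lemma invNum_step {σ : Equiv.Perm (Fin n)} {m j : Fin n} (hmj : (m : ℕ) + 1 = j) (h : σ j < σ m) :
    invNum σ = invNum (σ * Equiv.swap m j) + 1 := by
  classical
  unfold invNum
  have key : (Finset.univ.filter (fun p : Fin n × Fin n => p.1 < p.2 ∧ σ p.2 < σ p.1)) =
      insert (m, j) ((Finset.univ.filter (fun p : Fin n × Fin n => p.1 < p.2 ∧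
        (σ * Equiv.swap m j) p.2 < (σ * Equiv.swap m j) p.1)).image
          (fun p => (Equiv.swap m j p.1, Equiv.swap m j p.2))) := by
    ext ⟨x, y⟩
    simp only [Finset.mem_filter, Finset.mem_univ, true_and, Finset.mem_insert, Finset.mem_image,
      Prod.mk.injEq, Prod.exists]
    constructor
    · rintro ⟨h1, h2⟩
      by_cases hc : x = m ∧ y = j
      · exact Or.inl hc
      · right
        refine ⟨Equiv.swap m j x, Equiv.swap m j y, ⟨?_, ?_⟩, by simp, by simp⟩
        · simp only [Equiv.swap_apply_def]
          grind
        · simpa using h2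
    · rintro (⟨rfl, rfl⟩ | ⟨a, b, ⟨h1, h2⟩, rfl, rfl⟩)
      · exact ⟨by rw [Fin.lt_def]; omega, h⟩
      · refine ⟨?_, by simpa using h2⟩
        have : ¬ (a = m ∧ b = j) := by
          rintro ⟨rfl, rfl⟩
          simp at h2
          exact absurd h (not_lt.2 h2.le)
        simp only [Equiv.swap_apply_def]
        grind
  rw [key, Finset.card_insert_of_notMem, Finset.card_image_of_injective]
  · rintro ⟨a, b⟩ ⟨c, d⟩ h
    simpa using h
  · simp only [Finset.mem_image, Finset.mem_filter, Finset.mem_univ, true_and, not_exists, not_and,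
      Prod.mk.injEq, Prod.forall]
    rintro a b ⟨h1, h2⟩ h3 h4
    have ha : a = j := by
      have := congrArg (Equiv.swap m j) h3
      simpa using this
    have hb : b = m := by
      have := congrArg (Equiv.swap m j) h4
      simpa using this
    subst ha hb
    rw [Fin.lt_def] at h1
    omega

lemma invNum_inv (σ : Equiv.Perm (Fin n)) : invNum σ⁻¹ = invNum σ := by
  unfold invNum
  apply Finset.card_bij' (fun p _ => (σ⁻¹ p.2, σ⁻¹ p.1)) (fun p _ => (σ p.2, σ p.1)) <;> simp <;> tauto

noncomputable def N (σ : Equiv.Perm (Fin n)) : ℕ :=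
  Nat.card {τ : Equiv.Perm (Fin n) // isTransposition τ ∧ bruhatLE τ σ}

def S (σ : Equiv.Perm (Fin n)) : Set (Fin n × Fin n) := {p | (tabP σ).t p.1 p.2}

lemma N_eq (σ : Equiv.Perm (Fin n)) : N σ = (S σ).ncard := by
  have : {τ : Equiv.Perm (Fin n) | isTransposition τ ∧ bruhatLE τ σ} =
      (fun p : Fin n × Fin n => Equiv.swap p.1 p.2) '' S σ := by
    ext τ
    constructor
    · rintro ⟨⟨i, j, hij, rfl⟩, h⟩
      exact ⟨(i, j), ⟨hij, (swap_le hij).1 h⟩, rfl⟩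
    · rintro ⟨⟨i, j⟩, ⟨hij, h⟩, rfl⟩
      exact ⟨⟨i, j, hij, rfl⟩, (swap_le hij).2 h⟩
  have h2 : N σ = ({τ : Equiv.Perm (Fin n) | isTransposition τ ∧ bruhatLE τ σ}).ncard := rfl
  rw [h2, this]
  apply Set.InjOn.ncard_image
  rintro ⟨i, j⟩ ⟨hij, -⟩ ⟨k, l⟩ ⟨hkl, -⟩ h
  simp only at h hij hkl
  have h1 := congrArg (fun e => e i) h
  have h2 := congrArg (fun e => e k) h
  simp only [Equiv.swap_apply_def] at h1 h2
  rw [Prod.mk.injEq]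
  grind

lemma N_inv (σ : Equiv.Perm (Fin n)) : N σ⁻¹ = N σ := by
  rw [N_eq, N_eq]
  unfold S
  rw [tabP_inv]
  rfl

lemma smooth_iff (σ : Equiv.Perm (Fin n)) : smooth σ ↔ invNum σ = N σ := Iff.rfl

def Pat (σ : Equiv.Perm (Fin n)) : Prop := avoids4231 σ ∧ covexillary σ

lemma Pat_inv {σ : Equiv.Perm (Fin n)} (h : Pat σ) : Pat σ⁻¹ := by
  obtain ⟨h1, h2⟩ := h
  constructor
  · rintro ⟨a, b, c, d, hab, hbc, hcd, h3, h4, h5⟩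
    exact h1 ⟨_, _, _, _, h3, h4, h5, by simpa using hab, by simpa using hbc, by simpa using hcd⟩
  · rintro ⟨a, b, c, d, hab, hbc, hcd, h3, h4, h5⟩
    exact h2 ⟨_, _, _, _, h3, h4, h5, by simpa using hab, by simpa using hbc, by simpa using hcd⟩

structure W (σ : Equiv.Perm (Fin n)) (i m j : Fin n) : Prop where
  him : i ≤ m
  hmj : (m : ℕ) + 1 = j
  fix : ∀ x < i, σ x = x
  hσ : σ j = i
  hs : j ≤ σ i

section
variable {σ : Equiv.Perm (Fin n)} {i m j : Fin n}

lemma W.hij (w : W σ i m j) : i < j := by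
  have := w.him; have := w.hmj
  grind

lemma fix_ge (hfix : ∀ x < i, σ x = x) {x : Fin n} (hx : i ≤ x) : i ≤ σ x := by
  by_contra hc
  push Not at hc
  have := σ.injective (hfix _ hc)
  rw [this] at hc
  exact absurd hx (not_le.2 hc)

lemma W.ge (w : W σ i m j) {x : Fin n} (hx : i ≤ x) : i ≤ σ x := fix_ge w.fix hx

lemma W.lt (w : W σ i m j) : σ j < σ m := by
  rw [w.hσ]
  refine lt_of_le_of_ne (w.ge w.him) ?_
  intro h
  rw [← w.hσ] at h
  have := σ.injective h
  have := w.hmj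
  grind

lemma W.t_mem (w : W σ i m j) : (tabP σ).t i j := by
  refine ⟨w.hij, ⟨i, le_rfl, w.hs⟩, F_inv_iff.2 ⟨j, le_rfl, ?_⟩⟩
  rw [w.hσ]

lemma W.t_not_mem (w : W σ i m j) : ¬ (tabP (σ * Equiv.swap m j)).t i j := by
  rintro ⟨-, -, h⟩
  rw [F_inv_iff] at h
  obtain ⟨x, h1, h2⟩ := h
  rw [mul_swap_apply] at h2
  have h3 := w.lt
  have h4 := w.hmj
  have h5 := w.hσ
  have h6 := w.him
  have h7 := w.ge (x := x)
  have h8 : σ x = σ j → x = j := fun h => σ.injective h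
  grind

lemma W.t_sub (w : W σ i m j) {a b : ℕ} (h : (tabP (σ * Equiv.swap m j)).t a b) : (tabP σ).t a b :=
  ⟨h.1, step_F w.hmj w.lt h.2.1, step_G w.hmj w.lt h.2.2⟩

lemma W.N_step (w : W σ i m j) : N (σ * Equiv.swap m j) + 1 ≤ N σ := by
  rw [N_eq, N_eq, Nat.add_one_le_iff]
  apply Set.ncard_lt_ncard _ (Set.toFinite _)
  refine ⟨fun p hp => w.t_sub hp, fun h => w.t_not_mem (h (a := (i, j)) w.t_mem)⟩

lemma W.N_step' (w : W σ i m j) (hN : N σ = N (σ * Equiv.swap m j) + 1) (a b : ℕ)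
    (h1 : (tabP σ).t a b) (h2 : ¬ (tabP (σ * Equiv.swap m j)).t a b) : a = i ∧ b = j := by
  by_contra hc
  rw [N_eq, N_eq] at hN
  have hb := F_lt h1.2.1
  have ha : a < n := h1.1.trans hb
  have hlt : (insert (i, j) (S (σ * Equiv.swap m j))).ncard < (S σ).ncard := by
    apply Set.ncard_lt_ncard _ (Set.toFinite _)
    constructor
    · rintro p (rfl | hp)
      · exact w.t_mem
      · exact w.t_sub hp
    · intro h
      rcases h (a := (⟨a, ha⟩, ⟨b, hb⟩)) h1 with h | h
      · simp only [Prod.mk.injEq] at h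
        exact hc ⟨by rw [← h.1], by rw [← h.2]⟩
      · exact h2 h
  have hnm : (i, j) ∉ S (σ * Equiv.swap m j) := fun h => w.t_not_mem h
  rw [Set.ncard_insert_of_notMem hnm] at hlt
  omega

/-- The 3412 pattern through the swapped pair. -/
lemma W.caseB (w : W σ i m j) (hP : Pat (σ * Equiv.swap m j))
    (hN : ∀ a b : ℕ, (tabP σ).t a b → ¬ (tabP (σ * Equiv.swap m j)).t a b → a = i ∧ b = j)
    {x q : Fin n} (hx : x < m) (hq : j < q) (h1 : i < σ q) (h2 : σ q < σ x) (h3 : σ x < σ m) :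
    False := by
  obtain ⟨P1, P2⟩ := hP
  have hmj := w.hmj
  have hmj' : m < j := by grind
  have hap := mul_swap_apply σ m j
  have hm' : (σ * Equiv.swap m j) m = i := by rw [hap, if_pos rfl, w.hσ]
  have hj' : (σ * Equiv.swap m j) j = σ m := by rw [hap, if_neg hmj'.ne', if_pos rfl]
  have hlo : ∀ z < m, (σ * Equiv.swap m j) z = σ z := by intro z hz; rw [hap]; grind
  have hhi : ∀ z, j < z → (σ * Equiv.swap m j) z = σ z := by intro z hz; rw [hap]; grind
  have him : i < m := by
    have := w.fix x
    grind
  by_cases hz : ∃ z < m, σ m < σ z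
  · obtain ⟨z, hz, hz'⟩ := hz
    rcases lt_trichotomy z x with hzx | hzx | hzx
    · apply P1
      refine ⟨z, x, j, q, hzx, by grind, hq, ?_⟩
      rw [hhi q hq, hlo x hx, hj', hlo z hz]
      exact ⟨h2, h3, hz'⟩
    · subst hzx; exact absurd h3 (not_lt.2 hz'.le)
    · apply P2
      refine ⟨x, z, m, q, hzx, hz, by grind, ?_⟩
      rw [hhi q hq, hlo x hx, hm', hlo z hz]
      exact ⟨h1, h2, by grind⟩
  · push Not at hz
    obtain ⟨p, hp, hpmax⟩ := Finset.exists_max_image (Finset.Iio m) σ ⟨x, by simpa using hx⟩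
    simp only [Finset.mem_Iio] at hp hpmax
    have hpm : σ p < σ m := by
      refine lt_of_le_of_ne (hz p hp) fun h => ?_
      have := σ.injective h
      grind
    have hpj : j ≤ σ p := w.hs.trans (hpmax i him)
    have hxp := hpmax x hx
    have hpm' : (σ p : ℕ) < σ m := hpm
    have hpj' : (j : ℕ) ≤ σ p := hpj
    have hxp' : (σ x : ℕ) ≤ σ p := hxp
    have him' : (i : ℕ) < m := him
    have A1 : ¬ F σ⁻¹ m (σ p + 1) := by
      intro hF
      have := hN m (σ p + 1) ⟨by omega, ⟨m, le_rfl, by omega⟩, hF⟩ (by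
        rintro ⟨-, ⟨y, hy1, hy2⟩, -⟩
        rcases lt_or_eq_of_le (show y ≤ m from hy1) with hy | hy
        · rw [hlo y hy] at hy2
          have : (σ y : ℕ) ≤ σ p := hpmax y hy
          omega
        · rw [hy, hm'] at hy2
          omega)
      omega
    rw [F_inv_iff] at A1
    push Not at A1
    have A2 : F (σ * Equiv.swap m j)⁻¹ m j := by
      by_contra hF
      have := hN m j ⟨by omega, ⟨i, by omega, w.hs⟩, F_inv_iff.2 ⟨j, le_rfl, by rw [w.hσ]; omega⟩⟩
        (fun h => hF h.2.2)
      omega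
    rw [F_inv_iff] at A2
    obtain ⟨q', hq1, hq2⟩ := A2
    have hjq' : j < q' := by
      refine lt_of_le_of_ne hq1 ?_
      rintro rfl
      rw [hj'] at hq2
      omega
    rw [hhi q' hjq'] at hq2
    have hq3 : (q' : ℕ) ≤ σ p := by
      by_contra hc
      have := A1 q' (by omega)
      omega
    have A3 := F_cut σ (a := σ p) ⟨m, by omega, by omega⟩
    rw [F_inv_iff] at A3
    obtain ⟨r, hr1, hr2⟩ := A3
    have hr3 := A1 r hr1
    have hne : σ r ≠ σ p := by
      intro h
      have := σ.injective h
      subst this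
      have : (r : ℕ) < m := hp
      omega
    apply P2
    have hqr : q' < r := by rw [Fin.lt_def]; omega
    refine ⟨p, j, q', r, hp.trans hmj', hjq', hqr, ?_⟩
    rw [hhi q' hjq', hhi r (hjq'.trans hqr), hlo p hp, hj']
    refine ⟨by rw [Fin.lt_def]; omega, lt_of_le_of_ne hr2 hne, hpm⟩

lemma W.caseA (w : W σ i m j) (hP : Pat (σ * Equiv.swap m j))
    (hN : ∀ a b : ℕ, (tabP σ).t a b → ¬ (tabP (σ * Equiv.swap m j)).t a b → a = i ∧ b = j)
    {y : Fin n} (hy : y < m) (h1 : i ≤ y) (h2 : σ y < σ m) :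
    False := by
  have hmj := w.hmj
  have hmj' : m < j := by grind
  have hap := mul_swap_apply σ m j
  have hiy : i < σ y := by
    refine lt_of_le_of_ne (w.ge h1) fun h => ?_
    rw [← w.hσ] at h
    have := σ.injective h
    grind
  have hiy' : (i : ℕ) < σ y := hiy
  by_cases hq : ∃ q, j < q ∧ σ q < σ y
  · obtain ⟨q, hq, hq'⟩ := hq
    have : i < σ q := by
      have hij := w.hij
      refine lt_of_le_of_ne (w.ge (hij.le.trans hq.le)) fun h => ?_
      rw [← w.hσ] at h
      have := σ.injective h
      grind
    exact w.caseB hP hN hy hq this hq' h2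
  push Not at hq
  have hlt : σ y < j := by
    by_contra hc
    push Not at hc
    have hc' : (j : ℕ) ≤ σ y := hc
    obtain ⟨v, hv, hv'⟩ := pigeon_s11 σ⁻¹ (Finset.Iic (σ y)) (insert j (Finset.Iio m)) (by
      refine lt_of_le_of_lt (Finset.card_insert_le _ _) ?_
      rw [Fin.card_Iio, Fin.card_Iic]
      omega)
    obtain ⟨x, rfl⟩ := σ.surjective v
    have hinv : σ⁻¹ (σ x) = x := by simp
    simp only [Finset.mem_Iic, hinv, Finset.mem_insert, Finset.mem_Iio] at hv hv'
    have hxm : x ≠ m := by rintro rfl; exact absurd hv (not_le.2 h2)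
    have hxj : j < x := by grind
    have := le_antisymm hv (hq x hxj)
    have := σ.injective this
    grind
  have := hN (σ y) j ⟨hlt, ⟨i, hiy'.le, w.hs⟩, F_inv_iff.2 ⟨j, le_rfl, by rw [w.hσ]; omega⟩⟩ (by
    rintro ⟨-, -, h⟩
    rw [F_inv_iff] at h
    obtain ⟨x, hx1, hx2⟩ := h
    have hx1' : j ≤ x := hx1
    have hx2' : (σ * Equiv.swap m j) x ≤ σ y := hx2
    rw [hap] at hx2'
    have h5 := hq x
    have h6 : σ x = σ y → x = y := fun h => σ.injective h
    grind)
  omega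

lemma W.pat_step (w : W σ i m j) (hP : Pat (σ * Equiv.swap m j))
    (hN : ∀ a b : ℕ, (tabP σ).t a b → ¬ (tabP (σ * Equiv.swap m j)).t a b → a = i ∧ b = j) :
    Pat σ := by
  have hmj := w.hmj
  have hmj' : m < j := by grind
  have hσ := w.hσ
  have hij := w.hij
  have hlt : ∀ a b, a < b → ¬ (a = m ∧ b = j) → Equiv.swap m j a < Equiv.swap m j b := by
    intro a b
    simp only [Equiv.swap_apply_def]
    grind
  have hge : ∀ x, j ≤ x → i ≤ σ x := fun x hx => w.ge (hij.le.trans hx)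
  constructor
  · rintro ⟨a, b, c, d, hab, hbc, hcd, h1, h2, h3⟩
    have n1 : ¬ (a = m ∧ b = j) := by
      rintro ⟨rfl, rfl⟩
      have := hge d (by grind)
      grind
    have n2 : ¬ (b = m ∧ c = j) := by
      rintro ⟨rfl, rfl⟩
      have := hge d (by grind)
      grind
    have n3 : ¬ (c = m ∧ d = j) := by
      rintro ⟨rfl, rfl⟩
      refine w.caseA hP hN hbc ?_ h2
      by_contra hc
      have := w.fix b (by grind)
      grind
    exact hP.1 ⟨_, _, _, _, hlt _ _ hab n1, hlt _ _ hbc n2, hlt _ _ hcd n3, by simpa using h1,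
      by simpa using h2, by simpa using h3⟩
  · rintro ⟨a, b, c, d, hab, hbc, hcd, h1, h2, h3⟩
    have n1 : ¬ (a = m ∧ b = j) := by
      rintro ⟨rfl, rfl⟩
      have := hge c (by grind)
      grind
    have n2 : ¬ (b = m ∧ c = j) := by
      rintro ⟨rfl, rfl⟩
      exact w.caseB hP hN hab hcd (by grind) h2 h3
    have n3 : ¬ (c = m ∧ d = j) := by
      rintro ⟨rfl, rfl⟩
      have := w.lt
      grind
    exact hP.2 ⟨_, _, _, _, hlt _ _ hab n1, hlt _ _ hbc n2, hlt _ _ hcd n3, by simpa using h1,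
      by simpa using h2, by simpa using h3⟩

end

lemma exists_W (σ : Equiv.Perm (Fin n)) (h : σ ≠ 1) :
    ∃ i m j, W σ i m j ∨ W σ⁻¹ i m j := by
  have hne : ((Finset.univ : Finset (Fin n)).filter (fun x => σ x ≠ x)).Nonempty := by
    by_contra hc
    apply h
    ext x
    rw [Finset.not_nonempty_iff_eq_empty, Finset.filter_eq_empty_iff] at hc
    have := hc (Finset.mem_univ x)
    simp at this
    simp [this]
  obtain ⟨i, hi, hmin⟩ := Finset.exists_min_image _ (fun x => x) hne
  simp only [Finset.mem_filter, Finset.mem_univ, true_and] at hi hmin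
  have hfix : ∀ x < i, σ x = x := by
    intro x hx
    by_contra hc
    exact absurd (hmin x hc) (not_le.2 hx)
  have hfix' : ∀ x < i, σ⁻¹ x = x := by
    intro x hx
    rw [Equiv.Perm.inv_eq_iff_eq, hfix x hx]
  have h1 : i < σ i := lt_of_le_of_ne (fix_ge hfix le_rfl) (Ne.symm hi)
  have h2 : i < σ⁻¹ i := by
    refine lt_of_le_of_ne (fix_ge hfix' le_rfl) fun h => hi ?_
    rw [eq_comm, Equiv.Perm.inv_eq_iff_eq] at h
    exact h.symm
  have key : ∀ τ : Equiv.Perm (Fin n), (∀ x < i, τ x = x) → i < τ⁻¹ i → τ⁻¹ i ≤ τ i →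
      ∃ m j, W τ i m j := by
    intro τ hτ h3 h4
    have h3' : (i : ℕ) < τ⁻¹ i := h3
    refine ⟨⟨(τ⁻¹ i : ℕ) - 1, by omega⟩, τ⁻¹ i, ?_, ?_, hτ, by simp, h4⟩
    · rw [Fin.le_def]; simp only; omega
    · simp only; omega
  rcases le_total (σ⁻¹ i) (σ i) with hle | hle
  · obtain ⟨m, j, w⟩ := key σ hfix h2 hle
    exact ⟨i, m, j, Or.inl w⟩
  · obtain ⟨m, j, w⟩ := key σ⁻¹ hfix' (by simpa using h1) (by simpa using hle)
    exact ⟨i, m, j, Or.inr w⟩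

lemma N_ge_and_pat : ∀ (k : ℕ) (σ : Equiv.Perm (Fin n)), invNum σ = k →
    k ≤ N σ ∧ (N σ = k → Pat σ) := by
  intro k
  induction k using Nat.strong_induction_on with
  | _ k ih =>
    intro σ hσ
    by_cases h1 : σ = 1
    · subst h1
      have h0 : invNum (1 : Equiv.Perm (Fin n)) = 0 := by
        unfold invNum
        rw [Finset.card_eq_zero, Finset.filter_eq_empty_iff]
        rintro p - ⟨h1, h2⟩
        exact absurd h1 (not_lt.2 (le_of_lt h2))
      refine ⟨by omega, fun _ => ⟨?_, ?_⟩⟩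
      · rintro ⟨a, b, c, d, h1, h2, h3, h4, h5, h6⟩
        simp only [Equiv.Perm.one_apply] at *
        grind
      · rintro ⟨a, b, c, d, h1, h2, h3, h4, h5, h6⟩
        simp only [Equiv.Perm.one_apply] at *
        grind
    have key : ∀ (τ : Equiv.Perm (Fin n)) i m j, invNum τ = k → W τ i m j →
        k ≤ N τ ∧ (N τ = k → Pat τ) := by
      intro τ i m j hτ w
      have h2 := invNum_step w.hmj w.lt
      have h3 := ih (invNum (τ * Equiv.swap m j)) (by omega) _ rfl
      have h4 := w.N_step
      refine ⟨by omega, fun h5 => ?_⟩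
      exact w.pat_step (h3.2 (by omega)) (w.N_step' (by omega))
    obtain ⟨i, m, j, w | w⟩ := exists_W σ h1
    · exact key σ i m j hσ w
    · have := key σ⁻¹ i m j (by rw [invNum_inv, hσ]) w
      rw [N_inv] at this
      refine ⟨this.1, fun h => ?_⟩
      simpa using Pat_inv (this.2 h)

lemma smooth_pat {σ : Equiv.Perm (Fin n)} (h : smooth σ) : Pat σ :=
  (N_ge_and_pat _ σ rfl).2 h.symm

lemma smooth_inv {σ : Equiv.Perm (Fin n)} (h : smooth σ) : smooth σ⁻¹ := by
  rw [smooth_iff] at *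
  rw [invNum_inv, N_inv, h]

lemma W.smooth {σ : Equiv.Perm (Fin n)} {i m j : Fin n} (w : W σ i m j) (h : smooth σ) :
    smooth (σ * Equiv.swap m j) := by
  rw [smooth_iff] at *
  have h2 := invNum_step w.hmj w.lt
  have h3 := w.N_step
  have := (N_ge_and_pat _ (σ * Equiv.swap m j) rfl).1
  omega



section
variable {σ : Equiv.Perm (Fin n)} {i m j : Fin n}

lemma W.G_i (w : W σ i m j) {b : ℕ} : F σ⁻¹ i b ↔ b ≤ j := by
  rw [F_inv_iff]
  constructor
  · rintro ⟨x, h1, h2⟩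
    by_contra hc
    have hjx : j < x := by rw [Fin.lt_def]; omega
    have h3 := w.ge (w.hij.le.trans hjx.le)
    have h4 : σ x = σ j := by rw [w.hσ]; exact le_antisymm h2 h3
    have := σ.injective h4
    grind
  · intro h
    exact ⟨j, h, by rw [w.hσ]⟩

lemma W.G_i' (w : W σ i m j) {b : ℕ} : F (σ * Equiv.swap m j)⁻¹ i b ↔ b ≤ m := by
  have hmj := w.hmj
  rw [F_inv_iff]
  constructor
  · rintro ⟨x, h1, h2⟩
    rw [mul_swap_apply] at h2
    have h3 := w.lt
    have h5 := w.hσ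
    have h6 := w.him
    have h7 := w.ge (x := x)
    have h8 : σ x = σ j → x = j := fun h => σ.injective h
    grind
  · intro h
    exact ⟨m, h, by rw [mul_swap_apply, if_pos rfl, w.hσ]⟩

lemma W.F_eq (w : W σ i m j) (h1 : i < m → ∃ x < m, σ m < σ x) {a b : ℕ}
    (ha : a ≠ i ∨ i < m) : F (σ * Equiv.swap m j) a b ↔ F σ a b := by
  have hmj := w.hmj
  have him := w.him
  have hap := mul_swap_apply σ m j
  refine ⟨step_F w.hmj w.lt, ?_⟩
  rintro ⟨x, hx1, hx2⟩
  by_cases hxm : x = m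
  · subst hxm
    by_cases hi : i < x
    · obtain ⟨y, hy, hy'⟩ := h1 hi
      refine ⟨y, by grind, ?_⟩
      rw [hap]
      grind
    · refine ⟨j, by grind, ?_⟩
      rw [hap]
      grind
  · by_cases hxj : x = j
    · refine ⟨m, by grind, ?_⟩
      rw [hap]
      grind
    · refine ⟨x, hx1, ?_⟩
      rw [hap]
      grind

lemma W.G_eq (w : W σ i m j) (h2 : i < m → ∀ x, (σ x : ℕ) = i + 1 → m ≤ x) {a b : ℕ}
    (ha : a ≠ i) : F (σ * Equiv.swap m j)⁻¹ a b ↔ F σ⁻¹ a b := by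
  have hmj := w.hmj
  have him := w.him
  have hσ := w.hσ
  have hap := mul_swap_apply σ m j
  refine ⟨step_G w.hmj w.lt, ?_⟩
  intro hF
  have hbn := F_lt hF
  rw [F_inv_iff] at hF
  obtain ⟨x, hx1, hx2⟩ := hF
  by_cases hxm : x = m
  · rw [F_inv_iff]
    refine ⟨j, by grind, ?_⟩
    rw [hap]
    grind
  · by_cases hxj : x = j
    · subst hxj
      rw [hσ] at hx2
      by_cases hi : i < m
      · rw [F_inv_iff]
        have hi' : (i : ℕ) < m := hi
        obtain ⟨y, hy⟩ := σ.surjective ⟨i + 1, by omega⟩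
        have hy' : (σ y : ℕ) = i + 1 := by rw [hy]
        have hmy := h2 hi y hy'
        by_cases hym : y = m
        · refine ⟨x, hx1, ?_⟩
          rw [hap]
          grind
        · have hyj : y ≠ x := by
            rintro rfl
            rw [hσ] at hy'
            omega
          refine ⟨y, by grind, ?_⟩
          rw [hap]
          grind
      · apply F_of_le _ _ hbn
        grind
    · rw [F_inv_iff]
      refine ⟨x, hx1, ?_⟩
      rw [hap]
      grind

lemma F_fix_false (hfix : ∀ x < i, σ x = x) {a : ℕ} (ha : a < i) : ¬ F σ a i := by
  rintro ⟨x, h1, h2⟩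
  have : x < i := by rw [Fin.lt_def]; omega
  rw [hfix x this] at h2
  omega

lemma inv_fix (hfix : ∀ x < i, σ x = x) : ∀ x < i, σ⁻¹ x = x := by
  intro x hx
  rw [Equiv.Perm.inv_eq_iff_eq, hfix x hx]

lemma W.tab_der (w : W σ i m j) (h1 : i < m → ∃ x < m, σ m < σ x)
    (h2 : i < m → ∀ x, (σ x : ℕ) = i + 1 → m ≤ x) :
    tabP (σ * Equiv.swap m j) = (tabP σ).der i j := by
  have hmj := w.hmj
  have him : (i : ℕ) ≤ m := w.him
  have fF : ∀ a b, (a ≠ (i : ℕ) ∨ (i : ℕ) < m) → (F (σ * Equiv.swap m j) a b ↔ F σ a b) :=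
    fun a b h => w.F_eq h1 h
  have fG : ∀ a b, a ≠ (i : ℕ) → (F (σ * Equiv.swap m j)⁻¹ a b ↔ F σ⁻¹ a b) :=
    fun a b h => w.G_eq h2 h
  have gi : ∀ b, F σ⁻¹ i b ↔ b ≤ j := fun b => w.G_i
  have gi' : ∀ b, F (σ * Equiv.swap m j)⁻¹ i b ↔ b ≤ m := fun b => w.G_i'
  have e1 : ∀ a, a < (i : ℕ) → ¬ F σ a i := fun a => F_fix_false w.fix
  have e2 : ∀ a, a < (i : ℕ) → ¬ F σ⁻¹ a i := fun a => F_fix_false (inv_fix w.fix)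
  ext a b c
  · simp only [tabP, Tab.der]
    by_cases ha : a = i
    · subst ha
      rw [gi, gi']
      have := fF i b
      constructor
      · rintro ⟨x, y, z⟩
        exact ⟨⟨x, (this (by omega)).1 y, by omega⟩, by omega⟩
      · rintro ⟨⟨x, y, z⟩, z'⟩
        exact ⟨x, (this (by omega)).2 y, by omega⟩
    · rw [fF a b (Or.inl ha), fG a b ha]
      tauto
  · simp only [tabP, Tab.der]
    by_cases ha : a = i
    · subst ha
      rw [gi, gi']
      have := fF i b
      have := fF b c
      constructor
      · rintro ⟨x, x', y, y', z⟩
        exact ⟨⟨x, x', (fF i b (by omega)).1 y, (fF b c (by omega)).1 y', by omega⟩, by omega⟩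
      · rintro ⟨⟨x, x', y, y', z⟩, z'⟩
        exact ⟨x, x', (fF i b (by omega)).2 y, (fF b c (by omega)).2 y', by omega⟩
    · rw [fF a b (Or.inl ha), fG a c ha]
      by_cases hb : b = i
      · subst hb
        have := e1 a
        tauto
      · rw [fF b c (Or.inl hb)]
        tauto
  · simp only [tabP, Tab.der]
    by_cases ha : a = i
    · subst ha
      rw [gi, gi']
      constructor
      · rintro ⟨x, x', y, y', z⟩
        exact ⟨⟨x, x', by omega, (fG b c (by omega)).1 y', (fF i c (by omega)).1 z⟩, by omega⟩
      · rintro ⟨⟨x, x', y, y', z⟩, z'⟩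
        exact ⟨x, x', by omega, (fG b c (by omega)).2 y', (fF i c (by omega)).2 z⟩
    · rw [fF a c (Or.inl ha), fG a b ha]
      by_cases hb : b = i
      · subst hb
        have := e2 a
        tauto
      · rw [fG b c hb]
        tauto

/-- A value strictly between `i` and `σ i` located after position `m`. -/
lemma exists_mid {a : Fin n} (hfix : ∀ x < i, σ x = x) (hia : i < a) (hs : a < σ i) :
    ∃ x, a ≤ x ∧ i < σ x ∧ σ x < σ i := by
  have h1 : (i : ℕ) < a := hia
  have h2 : (a : ℕ) < σ i := hs
  obtain ⟨v, hv, hv'⟩ := pigeon_s11 σ⁻¹ (Finset.Ioo i (σ i)) (Finset.Ioo i a) (by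
    rw [Fin.card_Ioo, Fin.card_Ioo]; omega)
  obtain ⟨x, rfl⟩ := σ.surjective v
  have hinv : σ⁻¹ (σ x) = x := by simp
  simp only [Finset.mem_Ioo, hinv] at hv hv'
  refine ⟨x, ?_, hv.1, hv.2⟩
  by_contra hc
  have : x ≤ i := by grind
  rcases lt_or_eq_of_le this with h | h
  · rw [hfix x h] at hv
    grind
  · subst h
    grind

lemma W.h1_of_pat (w : W σ i m j) (hP : Pat σ) (him : i < m) : σ m < σ i := by
  by_contra hc
  have hmj := w.hmj
  have hlt : σ i < σ m := by
    refine lt_of_le_of_ne (not_lt.1 hc) fun h => ?_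
    have := σ.injective h
    grind
  have hs := w.hs
  obtain ⟨x, h1, h2, h3⟩ := exists_mid w.fix him (by grind)
  have hσ := w.hσ
  have hjx : j < x := by
    have : x ≠ m := by rintro rfl; grind
    have : x ≠ j := by rintro rfl; grind
    grind
  exact hP.2 ⟨i, m, j, x, him, by grind, hjx, by grind, h3, hlt⟩

lemma W.h2_of_pat (w : W σ i m j) (hP : Pat σ) (him : i < m) (x : Fin n)
    (hx : (σ x : ℕ) = i + 1) : m ≤ x := by
  by_contra hc
  have hmj := w.hmj
  have hs := w.hs
  have hσ := w.hσ
  have h1 := w.h1_of_pat hP him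
  have hlt := w.lt
  have hxi : x ≠ i := by rintro rfl; grind
  have hix : i < x := by
    by_contra hc
    have := w.fix x (by grind)
    grind
  have hne : σ x ≠ σ m := by
    intro h
    have := σ.injective h
    grind
  exact hP.1 ⟨i, x, m, j, hix, by grind, by grind, by grind, by grind, h1⟩

lemma W.tab_der_of_pat (w : W σ i m j) (hP : Pat σ) :
    tabP (σ * Equiv.swap m j) = (tabP σ).der i j :=
  w.tab_der (fun h => ⟨i, h, w.h1_of_pat hP h⟩) (fun h => w.h2_of_pat hP h)

lemma fix_of {k : ℕ} (h : ∀ a b, a < k → ¬ (tabP σ).t a b) (x : Fin n) (hx : (x : ℕ) < k) :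
    σ x = x := by
  induction x using WellFoundedLT.induction with
  | _ x ih =>
    have hle : σ x ≤ x := by
      by_contra hc
      have hc' : (x : ℕ) < σ x := not_le.1 hc
      have hF : F σ x (x + 1) := ⟨x, le_rfl, hc'⟩
      exact h x (x + 1) hx ⟨by omega, hF, F_cut σ hF⟩
    by_contra hne
    have hlt : σ x < x := lt_of_le_of_ne hle hne
    have := ih (σ x) hlt (by have : (σ x : ℕ) < x := hlt
                             omega)
    exact hne (σ.injective this)

end

lemma W_of_wedge {σ : Equiv.Perm (Fin n)} {i j : ℕ} (w : Wedge (tabP σ) i j) :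
    ∃ i' m' j' : Fin n, (i' : ℕ) = i ∧ (j' : ℕ) = j ∧ W σ i' m' j' := by
  obtain ⟨⟨hij, hF, hG⟩, hmin, hr⟩ := w
  have hj := F_lt hF
  have hi : i < n := by omega
  have hfix : ∀ x < (⟨i, hi⟩ : Fin n), σ x = x := fun x hx => fix_of hmin x hx
  obtain ⟨x, hx1, hx2⟩ := hF
  have hxi : x = ⟨i, hi⟩ := by
    by_contra hne
    have : x < ⟨i, hi⟩ := lt_of_le_of_ne hx1 hne
    rw [hfix x this] at hx2
    omega
  rw [F_inv_iff] at hG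
  obtain ⟨y, hy1, hy2⟩ := hG
  have hge := fix_ge hfix (x := y) (by rw [Fin.le_def]; simp only; omega)
  have hy3 : σ y = ⟨i, hi⟩ := le_antisymm hy2 hge
  refine ⟨⟨i, hi⟩, ⟨j - 1, by omega⟩, ⟨j, hj⟩, rfl, rfl, ?_, ?_, hfix, ?_, ?_⟩
  · rw [Fin.le_def]; simp only; omega
  · simp only; omega
  · have : (y : ℕ) = j := by
      by_contra hne
      have hG' : F σ⁻¹ j (j + 1) := F_inv_iff.2 ⟨y, by omega, by omega⟩
      have hF' := F_cut _ hG'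
      rw [inv_inv] at hF'
      exact hr (j + 1) ⟨hij, by omega, ⟨x, hx1, hx2⟩, hF', F_inv_iff.2 ⟨y, by omega, hy2⟩⟩
    have : y = ⟨j, hj⟩ := Fin.ext this
    rw [← this, hy3]
  · rw [← hxi]; exact hx2


lemma Ctab_admissible {σ : Equiv.Perm (Fin n)} (hP : Pat σ) : admissible (Ctab σ) := by
  refine ⟨fun τ h => h.1, fun τ h ρ h1 h2 => ⟨h1, bruhat_trans h2 h.2⟩, ?_, ?_⟩
  · rintro i j k l hij hjl hik hkl ⟨-, h1⟩ ⟨-, h2⟩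
    rw [Rc_le hij hjl] at h1
    rw [Lc_le hik hkl] at h2
    exact ⟨swap_inC (hij.trans hjl), (swap_le (hij.trans hjl)).2 ⟨h2.2.2, h1.2.2⟩⟩
  · rintro i j k hij hjk ⟨-, h1⟩ ⟨-, h2⟩
    rw [swap_le hij] at h1
    rw [swap_le hjk] at h2
    by_cases hF : F σ i k
    · exact Or.inr ⟨Lc_inC hij hjk, (Lc_le hij hjk).2 ⟨h1.2, h2.2, hF⟩⟩
    by_cases hG : F σ⁻¹ i k
    · exact Or.inl ⟨Rc_inC hij hjk, (Rc_le hij hjk).2 ⟨h1.1, h2.1, hG⟩⟩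
    exfalso
    simp only [F_inv_iff] at h1 h2 hG
    obtain ⟨⟨q, q1, q2⟩, ⟨q', q3, q4⟩⟩ := h1
    obtain ⟨⟨p, p1, p2⟩, ⟨p', p3, p4⟩⟩ := h2
    unfold F at hF
    push Not at hF hG
    have a1 := hF q q1
    have a2 := hF p
    have a3 := hG q'
    have a4 := hG p' p3
    have n1 : σ p ≠ σ q' := by rw [ne_eq, Fin.ext_iff]; omega
    have n2 : p ≠ q' := fun h => n1 (by rw [h])
    have n3 : q ≠ p' := by rw [ne_eq, Fin.ext_iff]; omega
    have n4 : σ q ≠ σ p' := fun h => n3 (σ.injective h)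
    rw [ne_eq, Fin.ext_iff] at n2 n4
    refine hP.2 ⟨q, p, q', p', ?_, ?_, ?_, ?_, ?_, ?_⟩ <;> rw [Fin.lt_def] <;> omega

lemma adm_tabP {σ : Equiv.Perm (Fin n)} (hP : Pat σ) : Adm n (tabP σ) := by
  rw [← tabA_Ctab]
  exact adm_of (Ctab_admissible hP)

lemma eq_one_of {σ : Equiv.Perm (Fin n)} (h : ¬ ∃ a b, (tabP σ).t a b) : σ = 1 := by
  push Not at h
  ext x
  rw [fix_of (k := n) (fun a b _ => h a b) x x.2]
  rfl

lemma tab_inj : ∀ (k : ℕ) (σ τ : Equiv.Perm (Fin n)), invNum σ = k → smooth σ → smooth τ →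
    tabP σ = tabP τ → σ = τ := by
  intro k
  induction k using Nat.strong_induction_on with
  | _ k ih =>
    have key : ∀ (i j : ℕ) (σ τ : Equiv.Perm (Fin n)), invNum σ = k → smooth σ → smooth τ →
        tabP σ = tabP τ → Wedge (tabP σ) i j → σ = τ := by
      intro i j σ τ hk hσ hτ h w
      obtain ⟨i1, m1, j1, hi1, hj1, w1⟩ := W_of_wedge w
      rw [h] at w
      obtain ⟨i2, m2, j2, hi2, hj2, w2⟩ := W_of_wedge w
      have e1 : i1 = i2 := by rw [Fin.ext_iff]; omega
      have e2 : j1 = j2 := by rw [Fin.ext_iff]; omega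
      have e3 : m1 = m2 := by
        have := w1.hmj
        have := w2.hmj
        rw [Fin.ext_iff]; omega
      subst e1 e2 e3
      have h1 := w1.tab_der_of_pat (smooth_pat hσ)
      have h2 := w2.tab_der_of_pat (smooth_pat hτ)
      have h3 := invNum_step w1.hmj w1.lt
      have := ih _ (by omega) (σ * Equiv.swap m1 j1) (τ * Equiv.swap m1 j1) rfl (w1.smooth hσ)
        (w2.smooth hτ) (by rw [h1, h2, h])
      exact mul_right_cancel this
    intro σ τ hk hσ hτ h
    by_cases hne : ∃ a b, (tabP σ).t a b
    · obtain ⟨i, j, w | w⟩ := wedge_exists (adm_tabP (smooth_pat hσ)) hne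
      · exact key i j σ τ hk hσ hτ h w
      · have := key i j σ⁻¹ τ⁻¹ (by rw [invNum_inv, hk]) (smooth_inv hσ) (smooth_inv hτ)
          (by rw [tabP_inv, tabP_inv, h]) (by rw [tabP_inv]; exact w)
        exact inv_injective this
    · have h2 : ¬ ∃ a b, (tabP τ).t a b := by rwa [← h]
      rw [eq_one_of hne, eq_one_of h2]



structure V (T : Tab) (s : Equiv.Perm (Fin n)) (i m j : Fin n) : Prop where
  hA : Adm n T
  w : Wedge T i j
  hmj : (m : ℕ) + 1 = j
  him : i ≤ m
  hP : Pat s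
  e : tabP s = T.der i j

section
variable {T : Tab} {s : Equiv.Perm (Fin n)} {i m j : Fin n}

lemma V.t_iff (v : V T s i m j) (a b : ℕ) :
    (a < b ∧ F s a b ∧ F s⁻¹ a b) ↔ (T.t a b ∧ ¬ (a = i ∧ b = j)) := by
  have := congrFun (congrFun (congrArg Tab.t v.e) a) b
  exact iff_of_eq this

lemma V.r_iff (v : V T s i m j) (a b c : ℕ) :
    (a < b ∧ b < c ∧ F s a b ∧ F s b c ∧ F s⁻¹ a c) ↔ (T.r a b c ∧ ¬ (a = i ∧ c = j)) := by
  have := congrFun (congrFun (congrFun (congrArg Tab.r v.e) a) b) c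
  exact iff_of_eq this

lemma V.l_iff (v : V T s i m j) (a b c : ℕ) :
    (a < b ∧ b < c ∧ F s⁻¹ a b ∧ F s⁻¹ b c ∧ F s a c) ↔ (T.l a b c ∧ ¬ (a = i ∧ b = j)) := by
  have := congrFun (congrFun (congrFun (congrArg Tab.l v.e) a) b) c
  exact iff_of_eq this

lemma V.fix (v : V T s i m j) : ∀ x < i, s x = x := by
  intro x hx
  refine fix_of (k := (i : ℕ)) (fun a b ha h => ?_) x hx
  exact v.w.hmin a b ha ((v.t_iff a b).1 h).1

lemma V.Fij (v : V T s i m j) (him : i < m) : F s i j := by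
  have hmj := v.hmj
  have h1 : (i : ℕ) < m := him
  have h : T.l i m j := (v.hA.dT _ _ v.w.ht).2.2 _ _ _ h1 (by omega) ⟨le_rfl, by omega⟩
    ⟨by omega, le_rfl⟩ ⟨le_rfl, le_rfl⟩
  exact ((v.l_iff _ _ _).2 ⟨h, by omega⟩).2.2.2.2

lemma V.js (v : V T s i m j) (him : i < m) : j ≤ s i := by
  obtain ⟨x, h1, h2⟩ := v.Fij him
  have hmj := v.hmj
  have h3 : (i : ℕ) < m := him
  have : x = i := by
    by_contra hne
    have := v.fix x (lt_of_le_of_ne h1 hne)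
    rw [this] at h2
    omega
  rw [this] at h2
  exact h2

lemma V.sm (v : V T s i m j) : s m = i := by
  have hmj := v.hmj
  have hnot : ¬ ((i : ℕ) < j ∧ F s i j ∧ F s⁻¹ i j) := by
    rw [v.t_iff]; simp
  rcases lt_or_eq_of_le v.him with him | him
  · have h1 : (i : ℕ) < m := him
    have h : T.t i m := (v.hA.dT _ _ v.w.ht).1 _ _ h1 ⟨le_rfl, by omega⟩ ⟨le_rfl, by omega⟩
    have h2 := ((v.t_iff _ _).2 ⟨h, by omega⟩).2.2
    have h3 : ¬ F s⁻¹ i j := fun h => hnot ⟨by omega, v.Fij him, h⟩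
    rw [F_inv_iff] at h2 h3
    push Not at h3
    obtain ⟨x, hx, hx'⟩ := h2
    have : x = m := by
      have := h3 x
      rw [Fin.ext_iff]; omega
    subst this
    exact le_antisymm hx' (fix_ge v.fix v.him)
  · subst him
    have h3 : ¬ F s i j := by
      intro h
      rw [← hmj] at h hnot
      exact hnot ⟨by omega, h, F_cut s h⟩
    refine le_antisymm ?_ (fix_ge v.fix le_rfl)
    by_contra hc
    exact h3 ⟨i, le_rfl, by rw [not_le, Fin.lt_def] at hc; omega⟩

lemma V.h1 (v : V T s i m j) (him : i < m) : ∃ x < m, s j < s x := by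
  by_contra hc
  push Not at hc
  have hmj := v.hmj
  have h3 : (i : ℕ) < m := him
  have hsm := v.sm
  have hjs : (j : ℕ) ≤ s i := v.js him
  obtain ⟨p, hp, hmax⟩ := (Finset.Iio m).exists_max_image s ⟨i, by simpa using him⟩
  simp only [Finset.mem_Iio] at hp hmax
  have hUi : (s i : ℕ) ≤ s p := hmax i him
  have hUj : (s p : ℕ) < s j := by
    refine lt_of_le_of_ne (hc p hp) fun h => ?_
    have := s.injective (Fin.ext h)
    have hp' : (p : ℕ) < m := hp
    rw [Fin.ext_iff] at this
    omega
  have hG : ¬ F s⁻¹ j ((s p : ℕ) + 1) := by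
    intro hG
    have t1 := ((v.t_iff j ((s p : ℕ) + 1)).1 ⟨by omega, ⟨j, le_rfl, hUj⟩, hG⟩).1
    rcases v.hA.c4 _ _ _ v.w.ht t1 with h | h
    · exact v.w.hr _ h
    · have l1 : T.l m j ((s p : ℕ) + 1) := (v.hA.dL _ _ _ h).2.2 _ _ _ (by omega) (by omega)
        (Or.inl ⟨by omega, le_rfl⟩) (Or.inr ⟨le_rfl, le_rfl⟩) ⟨by omega, le_rfl⟩
      obtain ⟨x, hx, hx'⟩ := ((v.l_iff _ _ _).2 ⟨l1, by omega⟩).2.2.2.2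
      rcases lt_or_eq_of_le hx with h | h
      · have : (s x : ℕ) ≤ s p := hmax x h
        omega
      · have : x = m := Fin.ext h
        rw [this, hsm] at hx'
        omega
  rw [F_inv_iff] at hG
  push Not at hG
  have t2 : T.t m j := (v.hA.dT _ _ v.w.ht).1 _ _ (by omega) ⟨by omega, le_rfl⟩ ⟨by omega, le_rfl⟩
  obtain ⟨q, hq, hq'⟩ := F_inv_iff.1 ((v.t_iff _ _).2 ⟨t2, by omega⟩).2.2
  have hqj : (q : ℕ) ≠ j := by
    intro h
    have : q = j := Fin.ext h
    rw [this] at hq'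
    omega
  have hjU : (j : ℕ) ≤ s p := by omega
  have hqU : (q : ℕ) ≤ s p := by
    by_contra hcc
    have := hG q (by omega)
    omega
  obtain ⟨r, hr, hr'⟩ := F_inv_iff.1 (F_cut s (a := (s p : ℕ)) ⟨j, hjU, hUj⟩)
  have hrj := hG r hr
  have hp' : (p : ℕ) < m := hp
  have hrp : (s r : ℕ) ≠ s p := by
    intro h
    have := s.injective (Fin.ext h)
    rw [Fin.ext_iff] at this
    omega
  exact v.hP.2 ⟨p, j, q, r, by rw [Fin.lt_def]; omega, by rw [Fin.lt_def]; omega,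
    by rw [Fin.lt_def]; omega, by rw [Fin.lt_def]; omega, by rw [Fin.lt_def]; omega, hUj⟩

lemma V.h2 (v : V T s i m j) (him : i < m) : ∃ x, j ≤ x ∧ (s x : ℕ) = i + 1 := by
  have hmj := v.hmj
  have h3 : (i : ℕ) < m := him
  have t2 : T.t (i + 1) j := (v.hA.dT _ _ v.w.ht).1 _ _ (by omega) ⟨by omega, le_rfl⟩
    ⟨by omega, le_rfl⟩
  obtain ⟨q, hq, hq'⟩ := F_inv_iff.1 ((v.t_iff _ _).2 ⟨t2, by omega⟩).2.2
  refine ⟨q, hq, ?_⟩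
  have h4 : (i : ℕ) ≤ s q := fix_ge v.fix (by rw [Fin.le_def]; omega)
  have h5 : (s q : ℕ) ≠ i := by
    intro h
    have : s q = s m := by rw [v.sm]; exact Fin.ext h
    have := s.injective this
    rw [Fin.ext_iff] at this
    omega
  omega

lemma V.Fic (v : V T s i m j) {c : ℕ} (hl : T.l i j c) : F (s * Equiv.swap m j) i c := by
  have hmj := v.hmj
  have hi : (i : ℕ) ≤ m := v.him
  have hl' := v.hA.l_lt _ _ _ hl
  have hsm := v.sm
  rcases lt_or_eq_of_le v.him with him | him
  · have h3 : (i : ℕ) < m := him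
    refine ⟨i, le_rfl, ?_⟩
    rw [mul_swap_apply, if_neg (by rw [Fin.ext_iff]; omega), if_neg (by rw [Fin.ext_iff]; omega)]
    have l1 : T.l (i + 1) j c := (v.hA.dL _ _ _ hl).2.2 _ _ _ (by omega) (by omega)
        (Or.inl ⟨by omega, le_rfl⟩) (Or.inr ⟨le_rfl, le_rfl⟩) ⟨by omega, le_rfl⟩
    obtain ⟨x, hx, hx'⟩ := ((v.l_iff _ _ _).2 ⟨l1, by omega⟩).2.2.2.2
    by_contra hc
    have hxi : (i : ℕ) < x := by
      by_contra hcc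
      rcases lt_or_eq_of_le (not_lt.1 hcc) with h | h
      · rw [v.fix x h] at hx'
        omega
      · have : x = i := Fin.ext h
        rw [this] at hx'
        exact hc hx'
    have hxm : (x : ℕ) ≠ m := by
      intro h
      have : x = m := Fin.ext h
      rw [this, hsm] at hx'
      omega
    have hjs : (j : ℕ) ≤ s i := v.js him
    obtain ⟨y, y1, y2, y3⟩ := exists_mid v.fix him (by rw [Fin.lt_def]; omega)
    have hym : y ≠ m := by
      rintro rfl
      rw [hsm] at y2
      exact lt_irrefl _ y2
    exact v.hP.2 ⟨i, x, m, y, hxi, by rw [Fin.lt_def]; omega, lt_of_le_of_ne y1 hym.symm,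
      by rw [hsm]; exact y2, y3, by rw [Fin.lt_def]; omega⟩
  · have hmi : (i : ℕ) = m := congrArg _ him
    have t1 : T.t j c := (v.hA.dL _ _ _ hl).1 _ _ (by omega) ⟨by omega, le_rfl⟩
      (Or.inr ⟨le_rfl, le_rfl⟩)
    obtain ⟨x, hx, hx'⟩ := ((v.t_iff _ _).2 ⟨t1, by omega⟩).2.1
    have hxj : x = j := by
      rw [Fin.ext_iff]
      by_contra hne
      by_cases hxi : x < i
      · rw [v.fix x hxi] at hx'
        omega
      · have : x = m := by
          rw [Fin.lt_def] at hxi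
          rw [Fin.ext_iff]; omega
        rw [this, hsm] at hx'
        omega
    refine ⟨i, le_rfl, ?_⟩
    rw [mul_swap_apply, if_pos him, ← hxj]
    exact hx'

lemma V.W (v : V T s i m j) : W (s * Equiv.swap m j) i m j := by
  have hmj := v.hmj
  have hi : (i : ℕ) ≤ m := v.him
  refine ⟨v.him, hmj, ?_, ?_, ?_⟩
  · intro x hx
    have hx' : (x : ℕ) < i := hx
    rw [mul_swap_apply, if_neg (by rw [Fin.ext_iff]; omega), if_neg (by rw [Fin.ext_iff]; omega),
      v.fix x hx]
  · rw [mul_swap_apply, if_neg (by rw [Fin.ext_iff]; omega), if_pos rfl, v.sm]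
  · rcases lt_or_eq_of_le v.him with him | him
    · have h3 : (i : ℕ) < m := him
      rw [mul_swap_apply, if_neg (by rw [Fin.ext_iff]; omega), if_neg (by rw [Fin.ext_iff]; omega)]
      exact v.js him
    · have h3 : (i : ℕ) = m := congrArg _ him
      rw [mul_swap_apply, if_pos him]
      have h4 : i ≤ s j := fix_ge v.fix (by rw [Fin.le_def]; omega)
      have h5 : s j ≠ i := by
        intro h
        rw [← v.sm] at h
        have := s.injective h
        rw [Fin.ext_iff] at this
        omega
      have := lt_of_le_of_ne h4 h5.symm
      rw [Fin.lt_def] at this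
      rw [Fin.le_def]
      omega

lemma V.tab (v : V T s i m j) : tabP (s * Equiv.swap m j) = T := by
  have hmj := v.hmj
  have w := v.W
  have hss : s * Equiv.swap m j * Equiv.swap m j = s := by rw [mul_assoc, Equiv.swap_mul_self, mul_one]
  have key := w.tab_der (by
    intro him
    obtain ⟨x, hx, hx'⟩ := v.h1 him
    have hx2 : (x : ℕ) < m := hx
    refine ⟨x, hx, ?_⟩
    rw [mul_swap_apply, if_pos rfl, mul_swap_apply, if_neg (by rw [Fin.ext_iff]; omega),
      if_neg (by rw [Fin.ext_iff]; omega)]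
    exact hx') (by
    intro him x hx
    obtain ⟨y, hy, hy'⟩ := v.h2 him
    have hy2 : (j : ℕ) ≤ y := hy
    have : s (Equiv.swap m j x) = s y := Fin.ext (by rw [hy', ← hx]; rfl)
    have := s.injective this
    rw [Equiv.swap_apply_def] at this
    rw [Fin.le_def]
    split_ifs at this with h1 h2
    · rw [h1]
    · rw [h2]; omega
    · rw [this]; omega)
  rw [hss, v.e] at key
  generalize hσ : s * Equiv.swap m j = σ at *
  have ht : ∀ a b : ℕ, ¬ (a = (i : ℕ) ∧ b = j) → ((tabP σ).t a b ↔ T.t a b) := by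
    intro a b h
    have := iff_of_eq (congrFun (congrFun (congrArg Tab.t key) a) b)
    simp only [Tab.der] at this
    tauto
  have hr : ∀ a b c : ℕ, ¬ (a = (i : ℕ) ∧ c = j) → ((tabP σ).r a b c ↔ T.r a b c) := by
    intro a b c h
    have := iff_of_eq (congrFun (congrFun (congrFun (congrArg Tab.r key) a) b) c)
    simp only [Tab.der] at this
    tauto
  have hl : ∀ a b c : ℕ, ¬ (a = (i : ℕ) ∧ b = j) → ((tabP σ).l a b c ↔ T.l a b c) := by
    intro a b c h
    have := iff_of_eq (congrFun (congrFun (congrFun (congrArg Tab.l key) a) b) c)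
    simp only [Tab.der] at this
    tauto
  have hij : (i : ℕ) < j := w.hij
  ext a b c
  · by_cases h : a = (i : ℕ) ∧ b = (j : ℕ)
    · obtain ⟨rfl, rfl⟩ := h
      exact iff_of_true w.t_mem v.w.ht
    · exact ht a b h
  · by_cases h : a = (i : ℕ) ∧ c = (j : ℕ)
    · obtain ⟨rfl, rfl⟩ := h
      constructor
      · rintro ⟨h1, h2, -⟩
        exact (v.hA.dT _ _ v.w.ht).2.1 _ _ _ h1 h2 ⟨le_rfl, by omega⟩ ⟨by omega, le_rfl⟩
          ⟨le_rfl, le_rfl⟩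
      · intro h
        obtain ⟨h1, h2, -⟩ := v.hA.r_lt _ _ _ h
        obtain ⟨-, f1, f2⟩ := w.t_mem
        exact ⟨h1, h2, F_mono f1 le_rfl (by omega), F_mono f1 (by omega) le_rfl, f2⟩
    · exact hr a b c h
  · by_cases h : a = (i : ℕ) ∧ b = (j : ℕ)
    · obtain ⟨rfl, rfl⟩ := h
      constructor
      · rintro ⟨h1, h2, h3, h4, h5⟩
        have := (ht j c (by omega)).1 ⟨h2, F_mono h5 (by omega) le_rfl, h4⟩
        exact (v.hA.c4 _ _ _ v.w.ht this).resolve_left (v.w.hr _)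
      · intro h
        have h1 := v.hA.l_lt _ _ _ h
        have t1 : T.t j c := (v.hA.dL _ _ _ h).1 _ _ (by omega) ⟨by omega, le_rfl⟩
          (Or.inr ⟨le_rfl, le_rfl⟩)
        have := (ht j c (by omega)).2 t1
        have hF := v.Fic h
        rw [hσ] at hF
        exact ⟨h1.1, h1.2.1, w.t_mem.2.2, this.2.2, hF⟩
    · exact hl a b c h

lemma V.smooth (v : V T s i m j) (hs : smooth s) : smooth (s * Equiv.swap m j) := by
  have w := v.W
  have hss : s * Equiv.swap m j * Equiv.swap m j = s := by rw [mul_assoc, Equiv.swap_mul_self, mul_one]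
  have h1 := invNum_step w.hmj w.lt
  have h2 := w.t_not_mem
  have ht := v.tab
  rw [hss] at h1 h2
  rw [smooth_iff] at hs ⊢
  rw [h1, hs, N_eq, N_eq, ← Set.ncard_insert_of_notMem (a := (i, j)) (s := S s) h2]
  congr 1
  ext ⟨a, b⟩
  simp only [S, ht, v.e, Tab.der, Set.mem_insert_iff, Set.mem_ofPred_eq, Prod.mk.injEq,
    Fin.ext_iff]
  constructor
  · rintro (⟨h, h'⟩ | h)
    · rw [h, h']; exact v.w.ht
    · exact h.1
  · tauto

end

lemma surj_step {T : Tab} {i j : ℕ} (hA : Adm n T) (w : Wedge T i j) {s : Equiv.Perm (Fin n)}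
    (hs : smooth s) (e : tabP s = T.der i j) :
    ∃ σ : Equiv.Perm (Fin n), smooth σ ∧ tabP σ = T := by
  have h := hA.t_lt _ _ w.ht
  have v : V T s ⟨i, by omega⟩ ⟨j - 1, by omega⟩ ⟨j, by omega⟩ :=
    ⟨hA, w, by simp only; omega, by rw [Fin.le_def]; simp only; omega, smooth_pat hs, e⟩
  exact ⟨_, v.smooth hs, v.tab⟩

lemma tab_finite {T : Tab} (hA : Adm n T) : {p : ℕ × ℕ | T.t p.1 p.2}.Finite := by
  refine ((Set.finite_Iio n).prod (Set.finite_Iio n)).subset ?_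
  rintro ⟨a, b⟩ h
  have := hA.t_lt _ _ h
  simp only [Set.mem_prod, Set.mem_Iio]
  omega

lemma tabP_one_t (a b : ℕ) : ¬ (tabP (1 : Equiv.Perm (Fin n))).t a b := by
  rintro ⟨h, ⟨x, h1, h2⟩, -⟩
  simp only [Equiv.Perm.one_apply] at h2
  omega

lemma smooth_one : smooth (1 : Equiv.Perm (Fin n)) := by
  rw [smooth_iff, N_eq]
  have h1 : S (1 : Equiv.Perm (Fin n)) = ∅ := by
    ext ⟨a, b⟩
    simpa [S] using tabP_one_t (n := n) a b
  rw [h1, Set.ncard_empty, invNum, Finset.card_eq_zero, Finset.filter_eq_empty_iff]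
  rintro ⟨a, b⟩ - ⟨h, h'⟩
  exact lt_asymm h h'

lemma tab_eq_of_empty {T T' : Tab} (hA : Adm n T) (hA' : Adm n T') (h : ∀ a b, ¬ T.t a b)
    (h' : ∀ a b, ¬ T'.t a b) : T = T' := by
  have key : ∀ T : Tab, Adm n T → (∀ a b, ¬ T.t a b) → (∀ a b c, ¬ T.r a b c) ∧
      (∀ a b c, ¬ T.l a b c) := by
    intro T hA h
    refine ⟨fun a b c hr => ?_, fun a b c hl => ?_⟩
    · have := hA.r_lt _ _ _ hr
      exact h a b ((hA.dR _ _ _ hr).1 a b this.1 (Or.inl ⟨le_rfl, le_rfl⟩) ⟨le_rfl, by omega⟩)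
    · have := hA.l_lt _ _ _ hl
      exact h a b ((hA.dL _ _ _ hl).1 a b this.1 ⟨le_rfl, by omega⟩ (Or.inl ⟨le_rfl, le_rfl⟩))
  ext a b c
  · exact iff_of_false (h a b) (h' a b)
  · exact iff_of_false ((key T hA h).1 a b c) ((key T' hA' h').1 a b c)
  · exact iff_of_false ((key T hA h).2 a b c) ((key T' hA' h').2 a b c)

lemma tab_surj : ∀ (k : ℕ) (T : Tab), {p : ℕ × ℕ | T.t p.1 p.2}.ncard = k → Adm n T →
    ∃ σ : Equiv.Perm (Fin n), smooth σ ∧ tabP σ = T := by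
  intro k
  induction k using Nat.strong_induction_on with
  | _ k ih =>
    have key : ∀ (i j : ℕ) (T : Tab), {p : ℕ × ℕ | T.t p.1 p.2}.ncard = k → Adm n T →
        Wedge T i j → ∃ σ : Equiv.Perm (Fin n), smooth σ ∧ tabP σ = T := by
      intro i j T hk hA w
      have hlt : {p : ℕ × ℕ | (T.der i j).t p.1 p.2}.ncard < k := by
        rw [← hk]
        refine Set.ncard_lt_ncard ⟨fun p hp => hp.1, fun h => ?_⟩ (tab_finite hA)
        exact (h (a := (i, j)) w.ht).2 ⟨rfl, rfl⟩
      obtain ⟨s, hs, e⟩ := ih _ hlt _ rfl (hA.der w)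
      exact surj_step hA w hs e
    intro T hk hA
    by_cases hne : ∃ a b, T.t a b
    · obtain ⟨i, j, w | w⟩ := wedge_exists hA hne
      · exact key i j T hk hA w
      · obtain ⟨σ, h1, h2⟩ := key i j T.inv hk hA.inv w
        refine ⟨σ⁻¹, smooth_inv h1, ?_⟩
        rw [tabP_inv, h2]
        rfl
    · push Not at hne
      exact ⟨1, smooth_one, tab_eq_of_empty (adm_tabP (smooth_pat smooth_one)) hA tabP_one_t hne⟩

/-- σ ↦ C(σ) is a bijection between smooth permutations and
admissible subsets of C^{2,3}. -/
theorem Ctab_bijection (n : ℕ) :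
    Set.BijOn (fun σ : Equiv.Perm (Fin n) => Ctab σ)
      {σ | smooth σ} {A | admissible A} := by
  refine ⟨fun σ hσ => Ctab_admissible (smooth_pat hσ), fun σ hσ τ hτ h => ?_, fun A hA => ?_⟩
  · have h' : Ctab σ = Ctab τ := h
    exact tab_inj _ σ τ rfl hσ hτ (by rw [← tabA_Ctab, h', tabA_Ctab])
  · obtain ⟨σ, h1, h2⟩ := tab_surj _ _ rfl (adm_of hA)
    refine ⟨σ, h1, ?_⟩
    rw [← tabA_Ctab] at h2
    exact Set.Subset.antisymm (tabA_sub (fun τ h => h.1) h2) (tabA_sub hA.1 h2.symm)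

end SmoothPerm
end
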